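/- arXiv:1104.4755 — 3 statements merged into one kernel-verified Lean document; each statement's English description precedes it below -/
import Mathlib

section
/- The T-space W_1 = {x + x^q}^S + {x^{q+1}}^S is a maximal T-space of k[x]₀; that is, W_1 ≠ k[x]₀, and every T-space V of k[x]₀ with W_1 ⊆ V and V ≠ W_1 satisfies V = k[x]₀. -/
open Polynomial

variable (k : Type*) [Field k] [Fintype k]

/-- `k[x]₀`: the free non-unital associative `k`-algebra on one generator `x`,
identified with the polynomials over `k` with zero constant term,
viewed as a `k`-submodule of `Polynomial k`. -/
noncomputable def A0 : Submodule k (Polynomial k) :=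
  LinearMap.ker (Polynomial.aeval (0 : k)).toLinearMap

/-- A `T`-space of `k[x]₀`: a `k`-linear subspace of `k[x]₀` closed under
substitutions `f ↦ f ∘ g` for `g ∈ k[x]₀`. -/
def IsTSpace (V : Submodule k (Polynomial k)) : Prop :=
  V ≤ A0 k ∧ ∀ f ∈ V, ∀ g ∈ A0 k, f.comp g ∈ V

/-- `H^S`: the smallest `T`-space of `k[x]₀` containing `H`. -/
noncomputable def TSp (H : Set (Polynomial k)) : Submodule k (Polynomial k) :=
  sInf {V | IsTSpace k V ∧ H ⊆ V}

/-- A `T`-ideal of `k[x]₀`: a `T`-space that is also an ideal of `k[x]₀`. -/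
def IsTIdeal (V : Submodule k (Polynomial k)) : Prop :=
  IsTSpace k V ∧ ∀ f ∈ V, ∀ g ∈ A0 k, g * f ∈ V

/-- `H^T`: the smallest `T`-ideal of `k[x]₀` containing `H`. -/
noncomputable def TId (H : Set (Polynomial k)) : Submodule k (Polynomial k) :=
  sInf {V | IsTIdeal k V ∧ H ⊆ V}

/-- `W_n = {x + x^{q^n}}^S + {x^{q^n+1}}^S`, where `q` is the order of `k`. -/
noncomputable def Wn (n : ℕ) : Submodule k (Polynomial k) :=
  TSp k {X + X ^ (Fintype.card k ^ n)} ⊔ TSp k {X ^ (Fintype.card k ^ n + 1)}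

/-- `U_n = {x - x^{q^{2n}}}^T`, where `q` is the order of `k`. -/
noncomputable def Un (n : ℕ) : Submodule k (Polynomial k) :=
  TId k {X - X ^ (Fintype.card k ^ (2 * n))}

theorem mem_A0 {f : k[X]} : f ∈ A0 k ↔ f.eval 0 = 0 := by
  simp [A0, LinearMap.mem_ker, Polynomial.coe_aeval_eq_eval]

theorem A0_isTSpace : IsTSpace k (A0 k) := by
  refine ⟨le_rfl, fun f hf g hg => ?_⟩
  rw [mem_A0] at *
  simp [eval_comp, hf, hg]

theorem TSp_isTSpace {H : Set k[X]} (hH : H ⊆ A0 k) : IsTSpace k (TSp k H) := by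
  refine ⟨sInf_le ⟨A0_isTSpace k, hH⟩, fun f hf g hg => ?_⟩
  simp only [TSp, Submodule.mem_sInf] at hf ⊢
  intro V hV
  exact hV.1.2 f (hf V hV) g hg

theorem subset_TSp {H : Set k[X]} : H ⊆ TSp k H := by
  intro f hf
  simp only [TSp, SetLike.mem_coe, Submodule.mem_sInf]
  intro V hV
  exact hV.2 hf

theorem TSp_le {H : Set k[X]} {V : Submodule k k[X]} (hV : IsTSpace k V) (hH : H ⊆ V) :
    TSp k H ≤ V := sInf_le ⟨hV, hH⟩

theorem qpos : Fintype.card k ≠ 0 := Fintype.card_ne_zero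

theorem X_mem_A0 {n : ℕ} (hn : n ≠ 0) : (X ^ n : k[X]) ∈ A0 k := by
  rw [mem_A0]; simp [hn]

theorem tr_mem {g : k[X]} (hg : g ∈ A0 k) : g + g ^ Fintype.card k ∈ Wn k 1 := by
  have h : ({X + X ^ (Fintype.card k ^ 1)} : Set k[X]) ⊆ A0 k := by
    rw [Set.singleton_subset_iff, SetLike.mem_coe, mem_A0]
    simp [qpos k]
  have := (TSp_isTSpace k h).2 _ (subset_TSp k (Set.mem_singleton _)) g hg
  refine Submodule.mem_sup_left ?_
  simpa using this

theorem nm_mem {g : k[X]} (hg : g ∈ A0 k) : g ^ (Fintype.card k + 1) ∈ Wn k 1 := by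
  have h : ({X ^ (Fintype.card k ^ 1 + 1)} : Set k[X]) ⊆ A0 k := by
    rw [Set.singleton_subset_iff, SetLike.mem_coe, mem_A0]
    simp
  have := (TSp_isTSpace k h).2 _ (subset_TSp k (Set.mem_singleton _)) g hg
  refine Submodule.mem_sup_right ?_
  simpa using this

theorem frob_add {R : Type*} [CommRing R] [Algebra k R] (a b : R) :
    (a + b) ^ Fintype.card k = a ^ Fintype.card k + b ^ Fintype.card k := by
  have := map_add (FiniteField.frobeniusAlgHom k R) a b
  simpa using this

theorem frob_sub {R : Type*} [CommRing R] [Algebra k R] (a b : R) :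
    (a - b) ^ Fintype.card k = a ^ Fintype.card k - b ^ Fintype.card k := by
  have := map_sub (FiniteField.frobeniusAlgHom k R) a b
  simpa using this

theorem mono_mem (s : ℕ) :
    (X ^ (Fintype.card k ^ 2 + s) - X ^ (s + 1) : k[X]) ∈ Wn k 1 := by
  have hq := qpos k
  rcases Nat.eq_zero_or_pos s with rfl | hs
  · have h1 := tr_mem k (X_mem_A0 k hq)
    have h2 := tr_mem k (X_mem_A0 k one_ne_zero)
    convert! Submodule.sub_mem _ h1 h2 using 1
    ring
  · have h0 : (X ^ Fintype.card k + X ^ s : k[X]) ∈ A0 k :=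
      Submodule.add_mem _ (X_mem_A0 k hq) (X_mem_A0 k hs.ne')
    have h1 := nm_mem k h0
    have h2 := nm_mem k (X_mem_A0 k hq)
    have h3 := nm_mem k (X_mem_A0 k hs.ne')
    have h4 := tr_mem k (X_mem_A0 k (Nat.succ_ne_zero s))
    convert! Submodule.sub_mem _ (Submodule.sub_mem _ (Submodule.sub_mem _ h1 h2) h3) h4 using 1
    rw [pow_succ (X ^ Fintype.card k + X ^ s : k[X]), frob_add, Nat.succ_eq_add_one]
    ring

theorem mul_mem_W (g : k[X]) :
    (X ^ (Fintype.card k ^ 2) - X) * g ∈ Wn k 1 := by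
  induction g using Polynomial.induction_on' with
  | add p q hp hq => rw [mul_add]; exact Submodule.add_mem _ hp hq
  | monomial n a =>
    have h := Submodule.smul_mem _ a (mono_mem k n)
    convert! h using 1
    rw [← C_mul_X_pow_eq_monomial, smul_eq_C_mul]
    ring

section ext

variable {K : Type} [Field K] [Fintype K] [Algebra k K]

/-- The space of polynomials taking Frobenius-fixed values on `K`. -/
noncomputable def fixedValued (K : Type) [Field K] [Fintype K] [Algebra k K] :
    Submodule k k[X] where
  carrier := {f | f ∈ A0 k ∧ ∀ a : K, (aeval a f) ^ Fintype.card k = aeval a f}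
  zero_mem' := ⟨Submodule.zero_mem _, fun a => by simp [qpos k]⟩
  add_mem' := by
    rintro f g ⟨hf, hf'⟩ ⟨hg, hg'⟩
    refine ⟨Submodule.add_mem _ hf hg, fun a => ?_⟩
    rw [map_add, frob_add, hf', hg']
  smul_mem' := by
    rintro c f ⟨hf, hf'⟩
    refine ⟨Submodule.smul_mem _ _ hf, fun a => ?_⟩
    rw [map_smul, Algebra.smul_def, mul_pow, ← map_pow, FiniteField.pow_card, hf']

theorem fixedValued_isTSpace : IsTSpace k (fixedValued k K) := by
  refine ⟨fun f hf => hf.1, fun f hf g hg => ⟨(A0_isTSpace k).2 f hf.1 g hg, fun a => ?_⟩⟩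
  rw [aeval_comp]
  exact hf.2 _

theorem frob_frob (hK : Fintype.card K = Fintype.card k ^ 2) (a : K) :
    (a ^ Fintype.card k) ^ Fintype.card k = a := by
  rw [← pow_mul, ← sq, ← hK, FiniteField.pow_card]

theorem W_le_fixedValued (hK : Fintype.card K = Fintype.card k ^ 2) :
    Wn k 1 ≤ fixedValued k K := by
  refine sup_le (TSp_le k (fixedValued_isTSpace k) ?_) (TSp_le k (fixedValued_isTSpace k) ?_)
  · rw [Set.singleton_subset_iff]
    refine ⟨by rw [mem_A0]; simp [qpos k], fun a => ?_⟩
    simp only [map_add, map_pow, aeval_X, pow_one]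
    rw [frob_add, frob_frob k hK, add_comm]
  · rw [Set.singleton_subset_iff]
    refine ⟨by rw [mem_A0]; simp, fun a => ?_⟩
    simp only [map_pow, aeval_X, pow_one]
    rw [pow_succ, mul_pow, frob_frob k hK, mul_comm]

theorem vanish_mem (hK : Fintype.card K = Fintype.card k ^ 2) (f : k[X])
    (hf : ∀ a : K, aeval a f = 0) : f ∈ Wn k 1 := by
  have hq : 1 < Fintype.card k := Fintype.one_lt_card
  have hq2 : 1 < Fintype.card k ^ 2 := Nat.one_lt_pow two_ne_zero hq
  have hm : (X ^ (Fintype.card k ^ 2) - X : k[X]).Monic :=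
    monic_X_pow_sub (by rw [degree_X]; exact_mod_cast hq2)
  have hd := modByMonic_add_div f (X ^ (Fintype.card k ^ 2) - X : k[X])
  have h0 : f %ₘ (X ^ (Fintype.card k ^ 2) - X : k[X]) = 0 := by
    rw [← Polynomial.map_eq_zero (algebraMap k K)]
    refine Polynomial.eq_zero_of_degree_lt_of_eval_finset_eq_zero
      (s := (Finset.univ : Finset K)) ?_ ?_
    · rw [degree_map, Finset.card_univ, hK]
      have := degree_modByMonic_lt f hm
      rwa [degree_eq_natDegree hm.ne_zero, FiniteField.X_pow_card_sub_X_natDegree_eq _ hq2] at this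
    · intro a _
      have h1 := congrArg (aeval a) hd
      rw [hf a, map_add, map_mul, map_sub, map_pow, aeval_X, ← hK, FiniteField.pow_card,
        sub_self, zero_mul, add_zero] at h1
      rw [eval_map_algebraMap, ← hK]
      exact h1
  rw [h0, zero_add] at hd
  rw [← hd]
  exact mul_mem_W k _

theorem fixedValued_le (hK : Fintype.card K = Fintype.card k ^ 2) :
    fixedValued k K ≤ Wn k 1 := by
  rintro f ⟨h0, hf⟩
  by_cases h2 : (2 : k) = 0
  · have hr : ringChar k = 2 := by
      have : ringChar k ∣ 2 := (ringChar.spec k 2).1 (by exact_mod_cast h2)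
      exact (Nat.prime_two.eq_one_or_self_of_dvd _ this).resolve_left (CharP.ringChar_ne_one)
    have he := FiniteField.even_card_iff_char_two.1 hr
    obtain ⟨m, hm⟩ : ∃ m, Fintype.card k = m * 2 := ⟨Fintype.card k / 2, by omega⟩
    have hm0 : m ≠ 0 := by rintro rfl; exact qpos k (by simpa using hm)
    have hh : f ^ m ∈ A0 k := by
      rw [mem_A0] at *
      simp [h0, hm0]
    have h1 := nm_mem k hh
    have h3 := vanish_mem k hK (f - (f ^ m) ^ (Fintype.card k + 1)) (fun a => by
      simp only [map_sub, map_pow]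
      rw [pow_succ, ← pow_mul, mul_comm m, pow_mul, hf a, ← sq, ← pow_mul, ← hm, hf a, sub_self])
    simpa using Submodule.add_mem _ h3 h1
  · have hh := Submodule.smul_mem _ ((2 : k)⁻¹) h0
    have h1 := tr_mem k hh
    have h3 := vanish_mem k hK (f - ((2 : k)⁻¹ • f + ((2 : k)⁻¹ • f) ^ Fintype.card k)) (fun a => by
      have h5 := ((fixedValued k K).smul_mem (2 : k)⁻¹ ⟨h0, hf⟩).2 a
      rw [map_sub, map_add, map_pow, h5, map_smul, ← add_smul, ← two_mul, mul_inv_cancel₀ h2,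
        one_smul, sub_self])
    simpa using Submodule.add_mem _ h3 h1

theorem exists_of_fixed (hK : Fintype.card K = Fintype.card k ^ 2) (c : K)
    (hc : c ^ Fintype.card k = c) : ∃ d : k, algebraMap k K d = c := by
  classical
  have hq : 1 < Fintype.card k := Fintype.one_lt_card
  by_contra hcon
  push Not at hcon
  let s : Finset K := insert c (Finset.univ.image (algebraMap k K))
  have hs : s.card = Fintype.card k + 1 := by
    rw [Finset.card_insert_of_notMem (by simpa using hcon),
      Finset.card_image_of_injective _ (algebraMap k K).injective, Finset.card_univ]
  have hz : (X ^ Fintype.card k - X : K[X]) = 0 := by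
    refine Polynomial.eq_zero_of_degree_lt_of_eval_finset_eq_zero (s := s) ?_ ?_
    · rw [degree_eq_natDegree (FiniteField.X_pow_card_sub_X_ne_zero _ hq),
        FiniteField.X_pow_card_sub_X_natDegree_eq _ hq, hs]
      exact_mod_cast Nat.lt_succ_self _
    · intro x hx
      rcases Finset.mem_insert.1 hx with rfl | hx
      · simp [hc]
      · obtain ⟨d, -, rfl⟩ := Finset.mem_image.1 hx
        simp [← map_pow, FiniteField.pow_card]
  exact FiniteField.X_pow_card_sub_X_ne_zero _ hq hz

theorem exists_lin (hK : Fintype.card K = Fintype.card k ^ 2) (c t : K)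
    (hc : c ^ Fintype.card k ≠ c) : ∃ u v : k, t = algebraMap k K v + algebraMap k K u * c := by
  have hc' : c - c ^ Fintype.card k ≠ 0 := sub_ne_zero.2 hc.symm
  obtain ⟨u, hu⟩ := exists_of_fixed k hK
    ((t - t ^ Fintype.card k) / (c - c ^ Fintype.card k)) (by
      rw [div_pow, frob_sub, frob_sub, frob_frob k hK, frob_frob k hK,
        ← neg_sub t, ← neg_sub c, neg_div_neg_eq])
  obtain ⟨v, hv⟩ := exists_of_fixed k hK (t - algebraMap k K u * c) (by
      rw [frob_sub, mul_pow, ← map_pow, FiniteField.pow_card]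
      rw [eq_div_iff hc'] at hu
      linear_combination hu)
  exact ⟨u, v, by rw [hv]; ring⟩

theorem exists_bump (hK : Fintype.card K = Fintype.card k ^ 2) (a b : K)
    (hb : b ^ Fintype.card k ≠ b) :
    ∃ g ∈ A0 k, aeval b g = a ∧
      ∀ x : K, x ≠ b → x ≠ b ^ Fintype.card k → aeval x g = 0 := by
  obtain ⟨u, v, huv⟩ := exists_lin k hK b a hb
  obtain ⟨T, hT⟩ := exists_of_fixed k hK (b + b ^ Fintype.card k) (by
    rw [frob_add, frob_frob k hK, add_comm])
  obtain ⟨N, hN⟩ := exists_of_fixed k hK (b * b ^ Fintype.card k) (by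
    rw [mul_pow, frob_frob k hK, mul_comm])
  have hK1 : Fintype.card K - 1 ≠ 0 := by
    have : 1 < Fintype.card K := Fintype.one_lt_card
    omega
  have key : ∀ x : K, aeval x ((C v + C u * X) *
      (1 - (X ^ 2 - C T * X + C N) ^ (Fintype.card K - 1)) : k[X]) =
      (algebraMap k K v + algebraMap k K u * x) *
        (1 - ((x - b) * (x - b ^ Fintype.card k)) ^ (Fintype.card K - 1)) := by
    intro x
    simp only [map_mul, map_add, map_sub, map_one, map_pow, aeval_X, aeval_C, hT, hN]
    congr 3
    ring
  have hz : ∀ x : K, x ≠ b → x ≠ b ^ Fintype.card k → aeval x ((C v + C u * X) *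
      (1 - (X ^ 2 - C T * X + C N) ^ (Fintype.card K - 1)) : k[X]) = 0 := by
    intro x h1 h2
    rw [key, FiniteField.pow_card_sub_one_eq_one _
      (mul_ne_zero (sub_ne_zero.2 h1) (sub_ne_zero.2 h2)), sub_self, mul_zero]
  have hb0 : b ≠ 0 := by
    rintro rfl
    exact hb (zero_pow (qpos k))
  refine ⟨_, ?_, ?_, hz⟩
  · have := hz 0 hb0.symm (pow_ne_zero _ hb0).symm
    rw [mem_A0]
    apply (algebraMap k K).injective
    rw [map_zero, ← this, ← aeval_algebraMap_apply_eq_algebraMap_eval, map_zero]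
  · rw [key, sub_self, zero_mul, zero_pow hK1, sub_zero, mul_one, huv]

theorem aeval_frob (f : k[X]) (b : K) :
    aeval (b ^ Fintype.card k) f = (aeval b f) ^ Fintype.card k := by
  have := aeval_algHom_apply (FiniteField.frobeniusAlgHom k K) b f
  simpa using this

theorem aeval_zero_A0 {f : k[X]} (hf : f ∈ A0 k) : aeval (0 : K) f = 0 := by
  rw [mem_A0] at hf
  rw [← map_zero (algebraMap k K), aeval_algebraMap_apply_eq_algebraMap_eval, hf]

theorem all_mem (hK : Fintype.card K = Fintype.card k ^ 2) {V : Submodule k k[X]}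
    (hV : IsTSpace k V) (hW : Wn k 1 ≤ V) {f : k[X]} (hf : f ∈ V) (a : K)
    (ha : (aeval a f) ^ Fintype.card k ≠ aeval a f) (n : ℕ) : ∀ t ∈ A0 k,
    Set.ncard {x : K | (aeval x t) ^ Fintype.card k ≠ aeval x t} = n → t ∈ V := by
  induction n using Nat.strong_induction_on with
  | _ n ih =>
    intro t ht hn
    by_cases hex : ∃ b : K, (aeval b t) ^ Fintype.card k ≠ aeval b t
    · obtain ⟨b, hb⟩ := hex
      have hbb : b ^ Fintype.card k ≠ b := by
        intro h
        apply hb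
        rw [← aeval_frob, h]
      obtain ⟨g, hg, hgb, hg0⟩ := exists_bump k hK a b hbb
      obtain ⟨u, v, huv⟩ := exists_lin k hK (aeval a f) (aeval b t) ha
      have hF : u • f.comp g ∈ V := Submodule.smul_mem _ _ (hV.2 f hf g hg)
      have hval : (aeval b (t - u • f.comp g)) = algebraMap k K v := by
        rw [map_sub, map_smul, aeval_comp, hgb, huv, Algebra.smul_def]
        ring
      have hvalf : (aeval b (t - u • f.comp g)) ^ Fintype.card k
          = aeval b (t - u • f.comp g) := by
        rw [hval, ← map_pow, FiniteField.pow_card]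
      have hmem : t - u • f.comp g ∈ V := by
        refine ih _ ?_ _ (Submodule.sub_mem _ ht (hV.1 hF)) rfl
        rw [← hn]
        refine Set.ncard_lt_ncard ?_ (Set.toFinite _)
        refine (Set.ssubset_iff_of_subset ?_).2 ⟨b, hb, fun h => h hvalf⟩
        intro x hx
        simp only [Set.mem_setOf_eq] at hx ⊢
        by_cases h1 : x = b
        · rw [h1]; exact hb
        by_cases h2 : x = b ^ Fintype.card k
        · exfalso
          apply hx
          rw [h2, aeval_frob, hvalf, hvalf]
        · have hz : aeval x (t - u • f.comp g) = aeval x t := by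
            rw [map_sub, map_smul, aeval_comp, hg0 x h1 h2, aeval_zero_A0 k (hV.1 hf),
              smul_zero, sub_zero]
          rwa [hz] at hx
      simpa using Submodule.add_mem _ hmem hF
    · push Not at hex
      exact hW (fixedValued_le k hK ⟨ht, hex⟩)

theorem main_of_ext (hK : Fintype.card K = Fintype.card k ^ 2) :
    Wn k 1 ≠ A0 k ∧
      ∀ V : Submodule k (Polynomial k),
        IsTSpace k V → Wn k 1 ≤ V → V ≠ Wn k 1 → V = A0 k := by
  classical
  have hq : 1 < Fintype.card k := Fintype.one_lt_card
  constructor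
  · intro h
    have hX : (X : k[X]) ∈ Wn k 1 := by
      rw [h, mem_A0]; simp
    have h1 := (W_le_fixedValued k hK hX).2
    have hsur : Function.Surjective (algebraMap k K) := fun c =>
      exists_of_fixed k hK c (by simpa using h1 c)
    have := Fintype.card_le_of_surjective _ hsur
    rw [hK] at this
    nlinarith
  · intro V hV hW hne
    refine le_antisymm hV.1 fun t ht => ?_
    obtain ⟨f, hf, hfW⟩ := SetLike.exists_of_lt (lt_of_le_of_ne hW hne.symm)
    have : ∃ a : K, (aeval a f) ^ Fintype.card k ≠ aeval a f := by
      by_contra hcon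
      push Not at hcon
      exact hfW (fixedValued_le k hK ⟨hV.1 hf, hcon⟩)
    obtain ⟨a, ha⟩ := this
    exact all_mem k hK hV hW hf a ha _ t ht rfl

end ext

/-- `W_1` is a maximal `T`-space of `k[x]₀`. -/
theorem W1_maximal_TSpace :
    Wn k 1 ≠ A0 k ∧
      ∀ V : Submodule k (Polynomial k),
        IsTSpace k V → Wn k 1 ≤ V → V ≠ Wn k 1 → V = A0 k := by
  have : Fact (ringChar k).Prime := ⟨CharP.char_is_prime k _⟩
  have : Fintype (FiniteField.Extension k (ringChar k) 2) := Fintype.ofFinite _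
  refine main_of_ext (K := FiniteField.Extension k (ringChar k) 2) k ?_
  have := FiniteField.natCard_extension k (ringChar k) 2
  simpa [Nat.card_eq_fintype_card] using this
end

section
/- For each n ≥ 1, the set {(x^{q^{2n}} − x)x^i : i ≥ 0} is a k-linear basis of U_n. -/
open Polynomial

variable (k : Type*) [Field k] [Fintype k]

theorem aux_pow_card (g : Polynomial k) (m : ℕ) :
    g ^ (Fintype.card k ^ m) = g.comp (X ^ (Fintype.card k ^ m)) := by
  induction m with
  | zero => simp
  | succ m ih =>
    rw [pow_succ, pow_mul, ih, ← FiniteField.expand_card, Polynomial.expand_eq_comp_X_pow,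
      Polynomial.comp_assoc]
    congr 1
    rw [Polynomial.X_pow_comp, ← pow_mul, mul_comm]

theorem aux_dvd (g : Polynomial k) (m : ℕ) :
    (X ^ (Fintype.card k ^ m) - X : Polynomial k) ∣ g ^ (Fintype.card k ^ m) - g := by
  have h := Polynomial.sub_dvd_eval_sub (X ^ (Fintype.card k ^ m) : Polynomial k) X
    (g.map (C : k →+* Polynomial k))
  rw [Polynomial.eval_map, Polynomial.eval_map] at h
  rw [aux_pow_card k g]
  have h2 : Polynomial.eval₂ (C : k →+* Polynomial k) X g = g := Polynomial.eval₂_C_X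
  rw [h2] at h
  exact h

theorem aux_mem_A0 (f : Polynomial k) : f ∈ A0 k ↔ f.eval 0 = 0 := by
  simp [A0, LinearMap.mem_ker, Polynomial.aeval_def, Polynomial.eval₂_eq_eval_map]

theorem aux_span (P : Polynomial k) (f : Polynomial k) :
    f ∈ Submodule.span k ({f | ∃ i : ℕ, f = P * X ^ i} : Set (Polynomial k)) ↔ P ∣ f := by
  constructor
  · intro h
    induction h using Submodule.span_induction with
    | mem x hx => obtain ⟨i, rfl⟩ := hx; exact dvd_mul_right _ _
    | zero => exact dvd_zero _
    | add x y _ _ hx hy => exact dvd_add hx hy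
    | smul a x _ hx => rw [Polynomial.smul_eq_C_mul]; exact Dvd.dvd.mul_left hx _
  · rintro ⟨h, rfl⟩
    induction h using Polynomial.induction_on' with
    | add p q hp hq => rw [mul_add]; exact Submodule.add_mem _ hp hq
    | monomial i a =>
      rw [← Polynomial.smul_X_eq_monomial, mul_smul_comm]
      exact Submodule.smul_mem _ _ (Submodule.subset_span ⟨i, rfl⟩)

/-- For each `n ≥ 1`, the set `{(x^{q^{2n}} - x) x^i : i ≥ 0}` is a `k`-linear
basis of `U_n`. -/
theorem basis_Un (n : ℕ) (hn : 1 ≤ n) :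
    LinearIndependent k
      (fun v : ↥({f | ∃ i : ℕ, f = (X ^ (Fintype.card k ^ (2 * n)) - X) * X ^ i} :
          Set (Polynomial k)) => (v : Polynomial k)) ∧
    Submodule.span k
        ({f | ∃ i : ℕ, f = (X ^ (Fintype.card k ^ (2 * n)) - X) * X ^ i} :
          Set (Polynomial k)) = Un k n := by
  have hq : 1 < Fintype.card k := Fintype.one_lt_card
  have hQ : 1 < Fintype.card k ^ (2 * n) := Nat.one_lt_pow (by omega) hq
  have hP : (X ^ (Fintype.card k ^ (2 * n)) - X : Polynomial k) ≠ 0 :=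
    FiniteField.X_pow_card_sub_X_ne_zero k hQ
  have hdvd := fun g : Polynomial k => aux_dvd k g (2 * n)
  have hP0 : (X ^ (Fintype.card k ^ (2 * n)) - X : Polynomial k).eval 0 = 0 := by
    have : Fintype.card k ^ (2 * n) ≠ 0 := by omega
    rw [Polynomial.eval_sub, Polynomial.eval_pow, Polynomial.eval_X, zero_pow this, sub_zero]
  have hcomp : ∀ g : Polynomial k, (X ^ (Fintype.card k ^ (2 * n)) - X : Polynomial k).comp g
      = g ^ (Fintype.card k ^ (2 * n)) - g := fun g => by
    rw [Polynomial.sub_comp, Polynomial.X_pow_comp, Polynomial.X_comp]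
  have hspan := aux_span k (X ^ (Fintype.card k ^ (2 * n)) - X : Polynomial k)
  have hneg : (X - X ^ (Fintype.card k ^ (2 * n)) : Polynomial k)
      = -(X ^ (Fintype.card k ^ (2 * n)) - X) := by ring
  unfold Un
  rw [hneg]
  generalize (X ^ (Fintype.card k ^ (2 * n)) - X : Polynomial k) = P at *
  constructor
  · have h1 : LinearIndependent k (fun i : ℕ => P * X ^ i) := by
      have h2 := (Polynomial.basisMonomials k).linearIndependent.map'
        (LinearMap.mulLeft k P)
        (LinearMap.ker_eq_bot.2 (mul_right_injective₀ hP))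
      have h5 : (fun i : ℕ => P * X ^ i)
          = (LinearMap.mulLeft k P) ∘ (Polynomial.basisMonomials k) := by
        funext i
        simp [Polynomial.X_pow_eq_monomial]
      rw [h5]
      exact h2
    have h3 := h1.linearIndepOn_id
    have h4 : Set.range (fun i : ℕ => P * X ^ i) = {f | ∃ i : ℕ, f = P * X ^ i} := by
      ext f; simp [eq_comm]
    rw [h4] at h3
    exact h3
  · apply le_antisymm
    · unfold TId
      refine le_sInf ?_
      rintro V ⟨hV, hPV⟩
      rw [Submodule.span_le]
      have hPm : P ∈ V := by
        have : -P ∈ V := hPV rfl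
        simpa using this
      rintro f ⟨i, rfl⟩
      rcases Nat.eq_zero_or_pos i with rfl | hi
      · simpa using hPm
      · rw [mul_comm]
        refine hV.2 _ hPm _ ?_
        rw [aux_mem_A0]
        simp [hi.ne']
    · unfold TId
      refine sInf_le ⟨⟨⟨?_, ?_⟩, ?_⟩, ?_⟩
      · intro f hf
        obtain ⟨h, rfl⟩ := (hspan f).1 hf
        rw [aux_mem_A0]
        simp [hP0]
      · intro f hf g _
        obtain ⟨h, rfl⟩ := (hspan f).1 hf
        rw [hspan, Polynomial.mul_comp, hcomp]
        exact Dvd.dvd.mul_right (hdvd g) _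
      · intro f hf g _
        rw [hspan] at hf ⊢
        exact Dvd.dvd.mul_left hf g
      · rintro f rfl
        exact (hspan _).2 (dvd_neg.2 dvd_rfl)
end

section
/- For every n ≥ 1 and all u, v ∈ k⟨X⟩₀, the element u·v^{q^n} + u^{q^n}·v belongs to W_{n,X}. -/
variable (k : Type*) [Field k] [Fintype k] (X : Type*)

/-- `k⟨X⟩₀`: the free non-unital associative `k`-algebra on `X`, identified with
the augmentation submodule (elements with zero constant term) of the free
unital associative algebra `FreeAlgebra k X`. -/
noncomputable def AugF : Submodule k (FreeAlgebra k X) :=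
  LinearMap.ker (FreeAlgebra.lift k (fun _ : X => (0 : k))).toLinearMap

/-- A `T`-space of `k⟨X⟩₀`: a `k`-linear subspace of `k⟨X⟩₀` invariant under all
substitutions `x ↦ g x` with each `g x ∈ k⟨X⟩₀` (equivalently, under all
non-unital `k`-algebra endomorphisms of `k⟨X⟩₀`). -/
def IsTSpaceF (V : Submodule k (FreeAlgebra k X)) : Prop :=
  V ≤ AugF k X ∧
    ∀ g : X → FreeAlgebra k X, (∀ x, g x ∈ AugF k X) →
      ∀ v ∈ V, FreeAlgebra.lift k g v ∈ V

/-- `H^S`: the smallest `T`-space of `k⟨X⟩₀` containing `H`. -/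
noncomputable def TSpF (H : Set (FreeAlgebra k X)) : Submodule k (FreeAlgebra k X) :=
  sInf {V | IsTSpaceF k X V ∧ H ⊆ V}

/-- A `T`-ideal of `k⟨X⟩₀`: a `T`-space that is also a (two-sided) ideal of `k⟨X⟩₀`. -/
def IsTIdealF (V : Submodule k (FreeAlgebra k X)) : Prop :=
  IsTSpaceF k X V ∧ ∀ v ∈ V, ∀ a ∈ AugF k X, a * v ∈ V ∧ v * a ∈ V

/-- `H^T`: the smallest `T`-ideal of `k⟨X⟩₀` containing `H`. -/
noncomputable def TIdF (H : Set (FreeAlgebra k X)) : Submodule k (FreeAlgebra k X) :=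
  sInf {V | IsTIdealF k X V ∧ H ⊆ V}

/-- `W_{n,X} = {x + x^{q^n}}^S + {x^{q^n+1}}^S` for a fixed generator `x ∈ X`. -/
noncomputable def WnF (x : X) (n : ℕ) : Submodule k (FreeAlgebra k X) :=
  TSpF k X {FreeAlgebra.ι k x + FreeAlgebra.ι k x ^ (Fintype.card k ^ n)} ⊔
    TSpF k X {FreeAlgebra.ι k x ^ (Fintype.card k ^ n + 1)}

/-- `U_{n,X} = {x - x^{q^{2n}}}^T` for a fixed generator `x ∈ X`. -/
noncomputable def UnF (x : X) (n : ℕ) : Submodule k (FreeAlgebra k X) :=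
  TIdF k X {FreeAlgebra.ι k x - FreeAlgebra.ι k x ^ (Fintype.card k ^ (2 * n))}


namespace WProof
open Finset

section SymProd
variable {R : Type*} [Ring R]

/-- signed sum of powers of partial sums -/
def FF (a : ℕ → R) (s : Finset ℕ) (m : ℕ) : R :=
  ∑ t ∈ s.powerset, (-1 : ℤ) ^ #(s \ t) • (∑ i ∈ t, a i) ^ m

/-- symmetrized product -/
def SS (a : ℕ → R) (s : Finset ℕ) : R := FF a s #s

lemma FF_add_erase (a : ℕ → R) (s : Finset ℕ) (m : ℕ) (i : ℕ) (hi : i ∈ s) :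
    FF a s m + FF a (s.erase i) m =
      ∑ t ∈ s.powerset with i ∈ t, (-1 : ℤ) ^ #(s \ t) • (∑ i ∈ t, a i) ^ m := by
  have h1 : FF a (s.erase i) m =
      - ∑ t ∈ s.powerset with ¬ i ∈ t, (-1 : ℤ) ^ #(s \ t) • (∑ i ∈ t, a i) ^ m := by
    unfold FF
    rw [← Finset.sum_neg_distrib]
    apply Finset.sum_congr
    · ext t
      simp only [mem_powerset, mem_filter]
      constructor
      · intro h
        exact ⟨h.trans (erase_subset _ _), fun h' => by simpa using h h'⟩
      · rintro ⟨h, h'⟩ x hx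
        exact mem_erase.2 ⟨fun e => h' (e ▸ hx), h hx⟩
    · intro t ht
      simp only [mem_filter, mem_powerset] at ht
      have : s \ t = insert i (s.erase i \ t) := by
        ext x
        by_cases hx : x = i
        · subst hx; simp [hi, ht.2]
        · simp [hx]
      rw [this, card_insert_of_notMem (by simp), pow_succ]
      simp
  rw [h1]
  unfold FF
  rw [← Finset.sum_filter_add_sum_filter_not s.powerset (fun t => i ∈ t)]
  abel

lemma FF_succ (a : ℕ → R) (s : Finset ℕ) (m : ℕ) :
    FF a s (m + 1) = ∑ i ∈ s, a i * (FF a s m + FF a (s.erase i) m) := by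
  have : ∀ i ∈ s, a i * (FF a s m + FF a (s.erase i) m) =
      ∑ t ∈ s.powerset with i ∈ t, (-1 : ℤ) ^ #(s \ t) • (a i * (∑ i ∈ t, a i) ^ m) := by
    intro i hi
    rw [FF_add_erase a s m i hi, Finset.mul_sum]
    simp only [mul_smul_comm]
  rw [Finset.sum_congr rfl this]
  unfold FF
  simp only [pow_succ' _ m, Finset.sum_mul, Finset.smul_sum]
  apply Finset.sum_comm'
  intro t i
  simp only [mem_powerset, mem_filter]
  constructor
  · rintro ⟨h, h'⟩; exact ⟨⟨h, h'⟩, h h'⟩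
  · rintro ⟨⟨h, h'⟩, _⟩; exact ⟨h, h'⟩

lemma FF_zero_of_lt (a : ℕ → R) (m : ℕ) : ∀ s : Finset ℕ, m < #s → FF a s m = 0 := by
  induction m with
  | zero =>
    intro s hs
    unfold FF
    simp only [pow_zero]
    rw [← Finset.sum_smul]
    have h2 : ∑ t ∈ s.powerset, (-1 : ℤ) ^ #(s \ t) = ∑ t ∈ s.powerset, (-1 : ℤ) ^ #t := by
      apply Finset.sum_nbij' (fun t => s \ t) (fun t => s \ t)
      · intro t _; simp
      · intro t _; simp
      · intro t ht; simp at ht; simp [ht]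
      · intro t ht; simp at ht; simp [ht]
      · intro t ht; rfl
    rw [h2, Finset.sum_powerset_neg_one_pow_card_of_nonempty (card_pos.1 hs), zero_smul]
  | succ m ih =>
    intro s hs
    rw [FF_succ]
    apply Finset.sum_eq_zero
    intro i hi
    rw [ih s (by omega), ih (s.erase i) (by rw [card_erase_of_mem hi]; omega)]
    simp

@[simp] lemma SS_empty (a : ℕ → R) : SS a ∅ = 1 := by simp [SS, FF]

lemma SS_rec (a : ℕ → R) (s : Finset ℕ) (hs : s.Nonempty) :
    SS a s = ∑ i ∈ s, a i * SS a (s.erase i) := by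
  unfold SS
  obtain ⟨m, hm⟩ : ∃ m, #s = m + 1 := ⟨#s - 1, by have := hs.card_pos; omega⟩
  rw [hm, FF_succ]
  apply Finset.sum_congr rfl
  intro i hi
  rw [FF_zero_of_lt a m s (by omega), zero_add, card_erase_of_mem hi, hm]
  simp

lemma SS_singleton (a : ℕ → R) (i : ℕ) : SS a {i} = a i := by
  rw [SS_rec _ _ (by simp)]; simp

lemma SS_congr {a b : ℕ → R} {s : Finset ℕ} (h : ∀ i ∈ s, a i = b i) : SS a s = SS b s := by
  unfold SS FF
  apply Finset.sum_congr rfl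
  intro t ht
  rw [Finset.sum_congr rfl (fun i hi => h i (mem_powerset.1 ht hi))]

lemma SS_insert (a : ℕ → R) : ∀ (n : ℕ) (s : Finset ℕ) (j : ℕ), #s = n → j ∉ s →
    SS a (insert j s) = ∑ t ∈ s.powerset, SS a t * a j * SS a (s \ t) := by
  intro n
  induction n with
  | zero =>
    intro s j hs hj
    rw [card_eq_zero] at hs
    subst hs
    simp [SS_singleton]
  | succ n ih =>
    intro s j hs hj
    rw [SS_rec _ _ (by simp), Finset.sum_insert hj, erase_insert hj]
    have h1 : ∀ i ∈ s, a i * SS a ((insert j s).erase i) =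
        ∑ t ∈ s.powerset with i ∈ t, a i * (SS a (t.erase i) * a j * SS a (s \ t)) := by
      intro i hi
      have hij : i ≠ j := fun h => hj (h ▸ hi)
      rw [erase_insert_of_ne hij.symm,
        ih (s.erase i) j (by rw [card_erase_of_mem hi]; omega) (by simp [hj]), Finset.mul_sum]
      apply Finset.sum_nbij' (fun t => insert i t) (fun t => t.erase i)
      · intro t ht
        simp only [mem_powerset, mem_filter] at ht ⊢
        exact ⟨insert_subset hi (ht.trans (erase_subset _ _)), mem_insert_self _ _⟩
      · intro t ht
        simp only [mem_powerset, mem_filter] at ht ⊢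
        exact erase_subset_erase _ ht.1
      · intro t ht
        simp only [mem_powerset] at ht
        exact erase_insert (fun h => by simpa using ht h)
      · intro t ht
        simp only [mem_powerset, mem_filter] at ht
        exact insert_erase ht.2
      · intro t ht
        simp only [mem_powerset] at ht
        rw [erase_insert (fun h => by simpa using ht h)]
        congr 3
        ext x
        simp only [mem_sdiff, mem_erase, mem_insert]
        tauto
    rw [Finset.sum_congr rfl h1]
    have h2 : ∑ i ∈ s, ∑ t ∈ s.powerset with i ∈ t, a i * (SS a (t.erase i) * a j * SS a (s \ t))
      = ∑ t ∈ s.powerset, ∑ i ∈ t, a i * (SS a (t.erase i) * a j * SS a (s \ t)) := by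
      apply Finset.sum_comm'
      intro i t
      simp only [mem_powerset, mem_filter]
      constructor
      · rintro ⟨_, h, h'⟩; exact ⟨h', h⟩
      · rintro ⟨h, h'⟩; exact ⟨h' h, h', h⟩
    rw [h2]
    have he : (∅ : Finset ℕ) ∈ s.powerset := by simp
    rw [← Finset.add_sum_erase _ _ he, ← Finset.add_sum_erase s.powerset
      (fun t => SS a t * a j * SS a (s \ t)) he]
    simp only [SS_empty, one_mul, sdiff_empty, Finset.sum_empty, zero_add]
    congr 1
    apply Finset.sum_congr rfl
    intro t ht
    rw [mem_erase] at ht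
    rw [SS_rec a t (nonempty_iff_ne_empty.2 ht.1), Finset.sum_mul, Finset.sum_mul]
    simp only [mul_assoc]

lemma SS_insert_one (a : ℕ → R) : ∀ (n : ℕ) (s : Finset ℕ) (j : ℕ), #s = n → j ∉ s → a j = 1 →
    SS a (insert j s) = (n + 1 : ℕ) * SS a s := by
  intro n
  induction n with
  | zero =>
    intro s j hs hj ha
    rw [card_eq_zero] at hs
    subst hs
    simp [SS_singleton, ha]
  | succ n ih =>
    intro s j hs hj ha
    rw [SS_rec _ _ (by simp), Finset.sum_insert hj, erase_insert hj, ha]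
    have h1 : ∀ i ∈ s, a i * SS a ((insert j s).erase i) =
        (n + 1 : ℕ) * (a i * SS a (s.erase i)) := by
      intro i hi
      have hij : i ≠ j := fun h => hj (h ▸ hi)
      rw [erase_insert_of_ne hij.symm,
        ih (s.erase i) j (by rw [card_erase_of_mem hi]; omega) (by simp [hj]) ha,
        ← mul_assoc, ← mul_assoc, Nat.cast_comm]
    rw [Finset.sum_congr rfl h1, ← Finset.mul_sum, ← SS_rec a s (card_pos.1 (by omega))]
    push_cast
    noncomm_ring

/-- derivation property -/
lemma SS_lie (a : ℕ → R) (c : R) : ∀ (n : ℕ) (s : Finset ℕ), #s = n →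
    SS a s * c - c * SS a s = ∑ i ∈ s, SS (Function.update a i (a i * c - c * a i)) s := by
  intro n
  induction n with
  | zero =>
    intro s hs
    rw [card_eq_zero] at hs
    subst hs
    simp
  | succ n ih =>
    intro s hs
    have hne : s.Nonempty := card_pos.1 (by omega)
    have h1 : ∀ i ∈ s, SS (Function.update a i (a i * c - c * a i)) s =
        (a i * c - c * a i) * SS a (s.erase i) +
        ∑ j ∈ s.erase i, a j * SS (Function.update a i (a i * c - c * a i)) (s.erase j) := by
      intro i hi
      rw [SS_rec _ s hne, ← Finset.add_sum_erase s _ hi, Function.update_self]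
      congr 1
      · congr 1
        apply SS_congr
        intro l hl
        rw [Function.update_of_ne (ne_of_mem_erase hl)]
      · apply Finset.sum_congr rfl
        intro j hj
        rw [Function.update_of_ne (ne_of_mem_erase hj)]
    rw [Finset.sum_congr rfl h1, Finset.sum_add_distrib]
    have h2 : ∑ i ∈ s, ∑ j ∈ s.erase i,
        a j * SS (Function.update a i (a i * c - c * a i)) (s.erase j) =
        ∑ j ∈ s, ∑ i ∈ s.erase j,
        a j * SS (Function.update a i (a i * c - c * a i)) (s.erase j) := by
      apply Finset.sum_comm'
      intro i j
      simp only [mem_erase]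
      tauto
    rw [h2]
    have h3 : ∀ j ∈ s, ∑ i ∈ s.erase j,
        a j * SS (Function.update a i (a i * c - c * a i)) (s.erase j) =
        a j * (SS a (s.erase j) * c - c * SS a (s.erase j)) := by
      intro j hj
      rw [ih (s.erase j) (by rw [card_erase_of_mem hj]; omega), Finset.mul_sum]
    rw [Finset.sum_congr rfl h3, ← Finset.sum_add_distrib, SS_rec a s hne, Finset.sum_mul,
      Finset.mul_sum, ← Finset.sum_sub_distrib]
    apply Finset.sum_congr rfl
    intro i _
    noncomm_ring

lemma SS_update_add (a : ℕ → R) (j : ℕ) (s : Finset ℕ) (hj : j ∈ s) (x y : R) :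
    SS (Function.update a j (x + y)) s =
      SS (Function.update a j x) s + SS (Function.update a j y) s := by
  obtain ⟨s', hs', rfl⟩ : ∃ s', j ∉ s' ∧ insert j s' = s := ⟨s.erase j, by simp, insert_erase hj⟩
  have key : ∀ z, SS (Function.update a j z) (insert j s') =
      ∑ t ∈ s'.powerset, SS a t * z * SS a (s' \ t) := by
    intro z
    rw [SS_insert _ _ s' j rfl hs']
    apply Finset.sum_congr rfl
    intro t ht
    rw [Function.update_self]
    have h1 : ∀ t ⊆ s', SS (Function.update a j z) t = SS a t := by
      intro t ht
      apply SS_congr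
      intro i hi
      rw [Function.update_of_ne]
      rintro rfl
      exact hs' (ht hi)
    rw [h1 t (mem_powerset.1 ht), h1 _ sdiff_subset]
  simp only [key, mul_add, add_mul, Finset.sum_add_distrib]

lemma SS_update_smul {k : Type*} [CommSemiring k] [Algebra k R]
    (a : ℕ → R) (j : ℕ) (s : Finset ℕ) (hj : j ∈ s) (c : k) (x : R) :
    SS (Function.update a j (c • x)) s = c • SS (Function.update a j x) s := by
  obtain ⟨s', hs', rfl⟩ : ∃ s', j ∉ s' ∧ insert j s' = s := ⟨s.erase j, by simp, insert_erase hj⟩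
  have key : ∀ z, SS (Function.update a j z) (insert j s') =
      ∑ t ∈ s'.powerset, SS a t * z * SS a (s' \ t) := by
    intro z
    rw [SS_insert _ _ s' j rfl hs']
    apply Finset.sum_congr rfl
    intro t ht
    rw [Function.update_self]
    have h1 : ∀ t ⊆ s', SS (Function.update a j z) t = SS a t := by
      intro t ht
      apply SS_congr
      intro i hi
      rw [Function.update_of_ne]
      rintro rfl
      exact hs' (ht hi)
    rw [h1 t (mem_powerset.1 ht), h1 _ sdiff_subset]
  simp only [key, Finset.smul_sum, mul_smul_comm, smul_mul_assoc]

lemma SS_map {R' : Type*} [Ring R'] (f : R →+* R') (a : ℕ → R) (s : Finset ℕ) :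
    f (SS a s) = SS (f ∘ a) s := by
  simp [SS, FF, map_sum, map_zsmul, map_pow]

end SymProd
end WProof


namespace WProof
open Finset

section Basic
variable {k R : Type*} [Field k] [Ring R] [Algebra k R]

/-- the T-space-like span -/
def Wm (Q : ℕ) (ε : R →ₐ[k] k) : Submodule k R :=
  Submodule.span k {x | ∃ a, ε a = 0 ∧ (x = a + a ^ Q ∨ x = a ^ (Q + 1))}

structure Ctx (Q : ℕ) (ε : R →ₐ[k] k) : Prop where
  two_le : 2 ≤ Q
  castQ : (Q : k) = 0
  frob : ∀ x y : R, Commute x y → (x + y) ^ Q = x ^ Q + y ^ Q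
  H : ∀ x : R, (∀ a b, a * x * b ∈ Wm Q ε) → x = 0

variable {Q : ℕ} {ε : R →ₐ[k] k}

lemma Wm_add (a : R) (ha : ε a = 0) : a + a ^ Q ∈ Wm Q ε :=
  Submodule.subset_span ⟨a, ha, Or.inl rfl⟩

lemma Wm_pow (a : R) (ha : ε a = 0) : a ^ (Q + 1) ∈ Wm Q ε :=
  Submodule.subset_span ⟨a, ha, Or.inr rfl⟩

lemma Wm_comm_aux (frob : ∀ x y : R, Commute x y → (x + y) ^ Q = x ^ Q + y ^ Q) (f h : R) (hf : ε f = 0) (hh : ε h = 0)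
    (hc : Commute f h) : f * h ^ Q + f ^ Q * h ∈ Wm Q ε := by
  have h1 := Wm_pow (Q := Q) (ε := ε) (f + h) (by simp [hf, hh])
  have h2 := Wm_pow (Q := Q) (ε := ε) f hf
  have h3 := Wm_pow (Q := Q) (ε := ε) h hh
  have e : f * h ^ Q + f ^ Q * h = (f + h) ^ (Q + 1) - f ^ (Q + 1) - h ^ (Q + 1) := by
    rw [pow_succ', frob f h hc, pow_succ', pow_succ', (hc.pow_left Q).eq]
    noncomm_ring
  rw [e]
  exact sub_mem (sub_mem h1 h2) h3

namespace Ctx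

lemma L1 (C : Ctx Q ε) (f h : R) (hf : ε f = 0) (hh : ε h = 0)
    (hc : Commute f h) : f * h ^ Q + f ^ Q * h ∈ Wm Q ε := Wm_comm_aux C.frob f h hf hh hc

lemma Qne (C : Ctx Q ε) : Q ≠ 0 := by have := C.two_le; omega

lemma Ltwo_a (C : Ctx Q ε) (a : R) (ha : ε a = 0) : a - a ^ (Q ^ 2) ∈ Wm Q ε := by
  have h1 := Wm_add (Q := Q) (ε := ε) a ha
  have h2 := Wm_add (Q := Q) (ε := ε) (a ^ Q) (by simp [ha, C.Qne])
  have := sub_mem h1 h2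
  rw [← pow_mul, ← sq] at this
  convert this using 1
  abel

lemma Ltwo_b (C : Ctx Q ε) (f h : R) (hf : ε f = 0) (hh : ε h = 0) (hc : Commute f h) :
    f * h - f * h ^ (Q ^ 2) ∈ Wm Q ε := by
  have h1 := C.L1 f (h ^ Q) hf (by simp [hh, C.Qne]) (hc.pow_right Q)
  have h2 := Wm_add (Q := Q) (ε := ε) (f * h) (by simp [hf])
  have := sub_mem h2 h1
  rw [hc.mul_pow, ← pow_mul, ← sq] at this
  convert this using 1
  abel

lemma Ltwo_c (C : Ctx Q ε) (a : R) (ha : ε a = 0) (j : ℕ) : a - a ^ ((Q ^ 2) ^ j) ∈ Wm Q ε := by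
  induction j with
  | zero => simp
  | succ j ih =>
    have h2 := C.Ltwo_a (a ^ ((Q ^ 2) ^ j)) (by simp [ha, C.Qne])
    have := add_mem ih h2
    rw [← pow_mul a ((Q ^ 2) ^ j), ← pow_succ] at this
    convert this using 1
    abel

lemma nil_mem (C : Ctx Q ε) (a : R) (ha : ε a = 0) (hn : IsNilpotent a) : a ∈ Wm Q ε := by
  obtain ⟨m, hm⟩ := hn
  have := C.Ltwo_c a ha m
  rwa [pow_eq_zero_of_le (m := m) _ hm, sub_zero] at this
  apply (Nat.lt_pow_self _).le
  have := C.two_le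
  nlinarith

lemma L3 (C : Ctx Q ε) (x : R) (hx : ε x = 0) (hn : ∀ a b, IsNilpotent (a * x * b)) : x = 0 :=
  C.H x fun a b => C.nil_mem _ (by simp [hx]) (hn a b)

lemma pow_mem_neg (C : Ctx Q ε) (a : R) (ha : ε a = 0) : a ^ Q + a ∈ Wm Q ε := by
  rw [add_comm]; exact Wm_add a ha

lemma FF_mem (C : Ctx Q ε) (a : ℕ → R) (ha : ∀ i, ε (a i) = 0) (s : Finset ℕ) (hs : 2 ≤ #s) :
    FF a s Q ∈ Wm Q ε := by
  have h : FF a s Q = FF a s Q + FF a s 1 := by rw [FF_zero_of_lt a 1 s hs, add_zero]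
  rw [h]
  unfold FF
  rw [← Finset.sum_add_distrib]
  refine Submodule.sum_mem _ fun t _ => ?_
  rw [← smul_add, pow_one]
  exact Submodule.smul_of_tower_mem _ _ (C.pow_mem_neg _ (by simp [ha]))

lemma SSQ_mem (C : Ctx Q ε) (a : ℕ → R) (ha : ∀ i, ε (a i) = 0) (s : Finset ℕ) (hs : #s = Q) :
    SS a s ∈ Wm Q ε := by
  unfold SS
  rw [hs]
  exact C.FF_mem a ha s (hs ▸ C.two_le)

lemma SSQ1_mem (a : ℕ → R) (ha : ∀ i, ε (a i) = 0) (s : Finset ℕ) (hs : #s = Q + 1) :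
    SS a s ∈ Wm Q ε := by
  unfold SS FF
  rw [hs]
  refine Submodule.sum_mem _ fun t _ => ?_
  exact Submodule.smul_of_tower_mem _ _ (Wm_pow _ (by simp [ha]))

end Ctx

/-- span of symmetrized products -/
def LL (Q : ℕ) (ε : R →ₐ[k] k) : Submodule k R :=
  Submodule.span k {x | ∃ a : ℕ → R, (∀ i, ε (a i) = 0) ∧ x = SS a (range Q)}

namespace Ctx

lemma LL_lie (x c : R) (hx : x ∈ LL Q ε) : x * c - c * x ∈ LL Q ε := by
  induction hx using Submodule.span_induction with
  | mem x hx =>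
    obtain ⟨a, ha, rfl⟩ := hx
    rw [SS_lie a c _ _ rfl]
    refine Submodule.sum_mem _ fun i _ => Submodule.subset_span ⟨_, ?_, rfl⟩
    intro j
    by_cases h : j = i
    · subst h; simp [ha]
    · simp [Function.update_of_ne h, ha]
  | zero => simp
  | add x y _ _ h1 h2 =>
    have := add_mem h1 h2
    convert this using 1
    noncomm_ring
  | smul r x _ h =>
    have := Submodule.smul_mem _ r h
    convert this using 1
    simp [smul_sub]


lemma LL_le (C : Ctx Q ε) : LL Q ε ≤ Wm Q ε := by
  unfold LL
  rw [Submodule.span_le]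
  rintro _ ⟨a, ha, rfl⟩
  exact C.SSQ_mem a ha _ (by simp)

lemma LL_eps (C : Ctx Q ε) (x : R) (hx : x ∈ LL Q ε) : ε x = 0 := by
  have h := C.LL_le hx
  clear hx
  induction h using Submodule.span_induction with
  | mem x hx =>
    obtain ⟨a, ha, rfl | rfl⟩ := hx <;> simp [ha, C.Qne]
  | zero => simp
  | add x y _ _ h1 h2 => simp [h1, h2]
  | smul r x _ h => simp [h]

lemma rot (C : Ctx Q ε) (i : R) (hi : ε i = 0) (hT : ∀ z z' z'', z * i * z' * z'' - z'' * (z * i * z') ∈ LL Q ε)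
    (s : R) (hs : s ∈ LL Q ε) : i * s ∈ Wm Q ε := by
  induction hs using Submodule.span_induction with
  | zero => simp
  | add x y _ _ h1 h2 => rw [mul_add]; exact add_mem h1 h2
  | smul r x _ h => rw [mul_smul_comm]; exact Submodule.smul_mem _ r h
  | mem x hx =>
    obtain ⟨a, ha, rfl⟩ := hx
    have hn : Q ∉ range Q := by simp
    have key : ∀ z, SS (Function.update a Q z) (insert Q (range Q)) =
        ∑ t ∈ (range Q).powerset, SS a t * z * SS a (range Q \ t) := by
      intro z
      rw [SS_insert _ _ (range Q) Q rfl hn]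
      apply Finset.sum_congr rfl
      intro t ht
      rw [Function.update_self]
      have h1 : ∀ t ⊆ range Q, SS (Function.update a Q z) t = SS a t := by
        intro t ht
        apply SS_congr
        intro i hi
        rw [Function.update_of_ne]
        rintro rfl
        exact hn (ht hi)
      rw [h1 t (mem_powerset.1 ht), h1 _ sdiff_subset]
    have hone := SS_insert_one (Function.update a Q 1) Q (range Q) Q (by simp) hn (by simp)
    rw [key] at hone
    simp only [mul_one] at hone
    have hQR : (Q : R) = 0 := by
      have := congrArg (algebraMap k R) C.castQ
      simpa using this
    have hu : SS (Function.update a Q 1) (range Q) = SS a (range Q) := by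
      apply SS_congr
      intro i hi
      rw [Function.update_of_ne]
      rintro rfl
      exact hn hi
    rw [hu] at hone
    push_cast at hone
    rw [hQR, zero_add, one_mul] at hone
    have hcomp : ∑ t ∈ (range Q).powerset, SS a (range Q \ t) * SS a t =
        ∑ t ∈ (range Q).powerset, SS a t * SS a (range Q \ t) := by
      apply Finset.sum_nbij' (fun t => range Q \ t) (fun t => range Q \ t)
      · intro t _; simp
      · intro t _; simp
      · intro t ht; simp only [mem_powerset] at ht; simp [ht]
      · intro t ht; simp only [mem_powerset] at ht; simp [ht]
      · intro t ht; simp only [mem_powerset] at ht; simp [ht]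
    have hmem : SS (Function.update a Q i) (insert Q (range Q)) ∈ Wm Q ε := by
      apply SSQ1_mem
      · intro j
        by_cases h : j = Q
        · subst h; simp [hi]
        · simp [Function.update_of_ne h, ha]
      · rw [card_insert_of_notMem hn]; simp
    rw [← hone, ← hcomp, Finset.mul_sum]
    have h3 : ∑ t ∈ (range Q).powerset, i * (SS a (range Q \ t) * SS a t) =
        SS (Function.update a Q i) (insert Q (range Q)) +
        ∑ t ∈ (range Q).powerset, (1 * i * SS a (range Q \ t) * SS a t
          - SS a t * (1 * i * SS a (range Q \ t))) := by
      rw [key, ← Finset.sum_add_distrib]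
      apply Finset.sum_congr rfl
      intro t _
      noncomm_ring
    rw [h3]
    exact add_mem hmem (Submodule.sum_mem _ fun t _ => C.LL_le (hT _ _ _))

/-- L4 -/
lemma LL_comm (C : Ctx Q ε) (s t : R) (hs : s ∈ LL Q ε) (ht : t ∈ LL Q ε) : s * t - t * s = 0 := by
  set T : Set R := {x | ∀ y, x * y - y * x ∈ LL Q ε} with hTdef
  have hLT : ∀ x ∈ LL Q ε, x ∈ T := fun x hx y => LL_lie x y hx
  have hTmul : ∀ x ∈ T, ∀ y ∈ T, x * y ∈ T := by
    intro x hx y hy a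
    have := add_mem (hx (y * a)) (hy (a * x))
    convert this using 1
    noncomm_ring
  have hTadd : ∀ x ∈ T, ∀ y ∈ T, x + y ∈ T := by
    intro x hx y hy a
    have := add_mem (hx a) (hy a)
    convert this using 1
    noncomm_ring
  have hTsub : ∀ x ∈ T, ∀ y ∈ T, x - y ∈ T := by
    intro x hx y hy a
    have := sub_mem (hx a) (hy a)
    convert this using 1
    noncomm_ring
  set w := s * t - t * s with hw
  have hwL : w ∈ LL Q ε := LL_lie s t hs
  have h1 : ∀ x, w * x ∈ T := by
    intro x
    have a1 : s * (t * x) - (t * x) * s ∈ T := hLT _ (LL_lie s (t * x) hs)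
    have a2 : t * (s * x - x * s) ∈ T := hTmul _ (hLT _ ht) _ (hLT _ (LL_lie s x hs))
    have := hTsub _ a1 _ a2
    convert this using 1
    rw [hw]
    noncomm_ring
  have h2 : ∀ y x, y * w * x ∈ T := by
    intro y x
    have a1 := h1 (x * y)
    have a2 := hLT _ (h1 x y)
    have := hTsub _ a1 _ a2
    convert this using 1
    noncomm_ring
  have hε : ε w = 0 := C.LL_eps w hwL
  have h3 : ∀ y x s', s' ∈ LL Q ε → y * w * x * s' ∈ Wm Q ε := by
    intro y x s' hs'
    apply C.rot _ (by simp [hε]) _ s' hs'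
    intro z z' z''
    have := h2 (z * y) (x * z') z''
    simpa only [mul_assoc] using this
  have h4 : ∀ x s', s' ∈ LL Q ε → w * x * s' = 0 := by
    intro x s' hs'
    apply C.H
    intro y z
    have a1 := h3 (z * y) x s' hs'
    have a2 := C.LL_le (h2 y (x * s') z)
    have := add_mem a2 a1
    convert this using 1
    noncomm_ring
  apply C.L3 w hε
  intro a b
  refine ⟨2, ?_⟩
  have := h4 (b * a) w hwL
  calc (a * w * b) ^ 2 = a * (w * (b * a) * w) * b := by noncomm_ring
    _ = 0 := by rw [this]; simp

/-- general form: all elements -/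
lemma SS_comm_ker (C : Ctx Q ε) (a b : ℕ → R) (ha : ∀ i, ε (a i) = 0) (hb : ∀ i, ε (b i) = 0) :
    SS a (range Q) * SS b (range Q) = SS b (range Q) * SS a (range Q) :=
  sub_eq_zero.1 (C.LL_comm _ _ (Submodule.subset_span ⟨a, ha, rfl⟩)
    (Submodule.subset_span ⟨b, hb, rfl⟩))

end Ctx
end Basic
end WProof


namespace WProof
open Polynomial

lemma isUnit_one_add_of_mem_jacobson {S : Type*} [Ring S] (y : S) (hy : y ∈ Ring.jacobson S) :
    IsUnit (1 + y) := by
  have key : ∀ y ∈ Ring.jacobson S, ∃ z, z * (1 + y) = 1 := by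
    intro y hy
    by_cases h : Ideal.span {1 + y} = ⊤
    · have : (1 : S) ∈ Ideal.span {1 + y} := by rw [h]; trivial
      obtain ⟨z, hz⟩ := Ideal.mem_span_singleton'.1 this
      exact ⟨z, hz⟩
    · exfalso
      obtain ⟨m, hm, hle⟩ := Ideal.exists_le_maximal _ h
      have h1 : 1 + y ∈ m := hle (Ideal.subset_span rfl)
      have h2 : y ∈ m := Ring.jacobson_le_of_isMaximal m hy
      exact hm.ne_top ((Ideal.eq_top_iff_one _).2 (by simpa using sub_mem h1 h2))
  obtain ⟨z, hz⟩ := key y hy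
  have hz' : z = 1 + (- z * y) := by
    rw [mul_add, mul_one] at hz
    rw [← hz]; noncomm_ring
  obtain ⟨w, hw⟩ := key (-z * y) (Ideal.mul_mem_left _ _ hy)
  rw [← hz'] at hw
  have : w = 1 + y := by
    calc w = w * (z * (1 + y)) := by rw [hz, mul_one]
      _ = 1 + y := by rw [← mul_assoc, hw, one_mul]
  subst this
  exact ⟨⟨1 + y, z, hw, hz⟩, rfl⟩

/-- Amitsur trick -/
lemma algebraic_of_units {K A : Type*} [Field K] [Ring A] [Algebra K A] [Nontrivial A]
    (hA : Module.rank K A ≤ Cardinal.aleph0) (d : A) (U : Set K) (hU : ¬ U.Countable)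
    (h : ∀ c ∈ U, IsUnit (d - algebraMap K A c)) : IsAlgebraic K d := by
  classical
  by_contra hna
  have hinj : ∀ p : K[X], aeval d p = 0 → p = 0 := by
    intro p hp
    by_contra hp0
    exact hna ⟨p, hp0, hp⟩
  have hi : ∀ c : U, ∃ e : A, e * (d - algebraMap K A c) = 1 := fun c => by
    obtain ⟨u, hu⟩ := h c c.2
    exact ⟨↑u⁻¹, by rw [← hu]; simp⟩
  choose e he using hi
  apply hU
  have hli : LinearIndependent K e := by
    rw [linearIndependent_iff']
    intro s g hg i hi
    have h1 : ∑ j ∈ s, g j • e j * aeval d (∏ l ∈ s, (X - C (l : K))) = 0 := by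
      rw [← Finset.sum_mul, hg, zero_mul]
    have h2 : ∀ j ∈ s, g j • e j * aeval d (∏ l ∈ s, (X - C (l : K))) =
        aeval d (C (g j) * ∏ l ∈ s.erase j, (X - C (l : K))) := by
      intro j hj
      rw [← Finset.mul_prod_erase s _ hj, map_mul, ← mul_assoc]
      simp only [map_sub, aeval_X, aeval_C, map_mul]
      rw [smul_mul_assoc, he j, Algebra.smul_def, mul_one]
    rw [Finset.sum_congr rfl h2, ← map_sum] at h1
    have h3 := congrArg (eval (i : K)) (hinj _ h1)
    rw [eval_finset_sum, Finset.sum_eq_single i] at h3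
    · simp only [eval_mul, eval_C, eval_prod, eval_sub, eval_X, eval_zero, mul_eq_zero] at h3
      rcases h3 with h3 | h3
      · exact h3
      · exfalso
        rw [Finset.prod_eq_zero_iff] at h3
        obtain ⟨l, hl, hl'⟩ := h3
        exact (Finset.ne_of_mem_erase hl) (Subtype.ext (sub_eq_zero.1 hl').symm)
    · intro j hj hji
      rw [eval_mul, eval_prod, Finset.prod_eq_zero (i := i)]
      · simp
      · exact Finset.mem_erase.2 ⟨hji.symm, hi⟩
      · simp
    · intro h; exact absurd hi h
  have := hli.cardinal_lift_le_rank
  have h2 : Cardinal.lift (Cardinal.mk U) ≤ Cardinal.aleph0 :=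
    this.trans (Cardinal.lift_le_aleph0.2 hA)
  exact Cardinal.mk_le_aleph0_iff.1 (Cardinal.lift_le_aleph0.1 h2)

lemma nilpotent_of_jacobson {K A : Type*} [Field K] [Uncountable K] [Ring A] [Algebra K A]
    (hA : Module.rank K A ≤ Cardinal.aleph0) (y : A) (hy : y ∈ Ring.jacobson A) :
    IsNilpotent y := by
  nontriviality A
  have h1 : IsAlgebraic K y := by
    apply algebraic_of_units hA y {c | c ≠ 0}
    · intro hc
      have : (Set.univ : Set K).Countable := by
        have h := hc.union (Set.countable_singleton (0 : K))
        apply h.mono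
        intro x _
        by_cases hx : x = 0
        · right; exact hx
        · left; exact hx
      exact not_countable (Set.countable_univ_iff.1 this)
    · intro c hc
      have hu := isUnit_one_add_of_mem_jacobson (algebraMap K A (-c⁻¹) * y)
        (Ideal.mul_mem_left _ _ hy)
      have e : y - algebraMap K A c = algebraMap K A (-c) * (1 + algebraMap K A (-c⁻¹) * y) := by
        rw [mul_add, ← mul_assoc, ← map_mul]
        have : -c * -c⁻¹ = 1 := by field_simp [show c ≠ 0 from hc]
        rw [this, map_one]
        simp
        abel
      rw [e]
      exact ((IsUnit.mk0 (-c) (neg_ne_zero.2 hc)).map (algebraMap K A)).mul hu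
  obtain ⟨p, hp0, hp⟩ := h1
  obtain ⟨g, hg1, hg2⟩ := p.exists_eq_pow_rootMultiplicity_mul_and_not_dvd hp0 0
  set m := rootMultiplicity 0 p
  refine ⟨m, ?_⟩
  have hg0 : g.coeff 0 ≠ 0 := by
    intro h
    apply hg2
    simpa using X_dvd_iff.2 h
  rw [hg1] at hp
  simp only [map_zero, sub_zero, map_mul, map_pow, aeval_X] at hp
  have hgu : IsUnit (aeval y g) := by
    have hd : aeval y g = algebraMap K A (g.coeff 0) *
        (1 + algebraMap K A ((g.coeff 0)⁻¹) * (aeval y g.divX * y)) := by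
      conv_lhs => rw [← divX_mul_X_add g]
      rw [mul_add, ← mul_assoc, ← map_mul, mul_inv_cancel₀ hg0]
      simp
      abel
    rw [hd]
    apply ((IsUnit.mk0 _ hg0).map (algebraMap K A)).mul
    apply isUnit_one_add_of_mem_jacobson
    exact Ideal.mul_mem_left _ _ (Ideal.mul_mem_left _ _ hy)
  exact (hgu.mul_left_eq_zero).1 hp

end WProof


namespace WProof
open Finset

lemma density {K A M : Type*} [Field K] [IsAlgClosed K] [Uncountable K] [Ring A] [Algebra K A]
    [AddCommGroup M] [Module K M] [Module A M] [IsScalarTower K A M] [IsSimpleModule A M]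
    (hM : Module.rank K M ≤ Cardinal.aleph0) {ι : Type*} [Finite ι] (v : ι → M)
    (hv : LinearIndependent K v)
    (w : ι → M) : ∃ a : A, ∀ i, a • v i = w i := by
  classical
  have := Fintype.ofFinite ι
  have : SMulCommClass A K M := IsScalarTower.to_smulCommClass'
  have : Nontrivial M := IsSimpleModule.nontrivial A M
  let _ : DivisionRing (Module.End A M) := Module.End.instDivisionRing
  have hscal : ∀ d : Module.End A M, ∃ c : K, d = algebraMap K (Module.End A M) c := by
    have hrk : Module.rank K (Module.End A M) ≤ Cardinal.aleph0 := by
      obtain ⟨m, hm⟩ := exists_ne (0 : M)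
      let f : Module.End A M →ₗ[K] M :=
        { toFun := fun d => d m
          map_add' := fun _ _ => rfl
          map_smul' := fun _ _ => rfl }
      have hf : Function.Injective f := by
        rw [injective_iff_map_eq_zero]
        intro d hd
        by_contra h0
        have hu : IsUnit d := IsUnit.mk0 d h0
        have := ((Module.End.isUnit_iff d).1 hu).1
        exact hm (this (by rw [map_zero]; exact hd))
      exact (LinearMap.rank_le_of_injective f hf).trans hM
    have : Algebra.IsIntegral K (Module.End A M) := by
      constructor
      intro d
      by_cases h : ∃ c : K, d = algebraMap K (Module.End A M) c
      · obtain ⟨c, rfl⟩ := h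
        exact isIntegral_algebraMap
      · push Not at h
        have : IsAlgebraic K d := by
          apply algebraic_of_units hrk d Set.univ
          · rw [Set.countable_univ_iff]; exact not_countable
          · intro c _
            exact IsUnit.mk0 _ (sub_ne_zero.2 (h c))
        exact isAlgebraic_iff_isIntegral.1 this
    intro d
    obtain ⟨c, hc⟩ := (IsAlgClosed.algebraMap_bijective_of_isIntegral (k := K)
      (K := Module.End A M)).2 d
    exact ⟨c, hc.symm⟩
  obtain ⟨f, hf⟩ : ∃ f : M →ₗ[K] M, ∀ i, f (v i) = w i := by
    refine ⟨(Module.Basis.extend hv.linearIndepOn_id).constr ℕ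
      (fun x => if h : ∃ i, v i = x then w h.choose else 0), fun i => ?_⟩
    have hx : v i ∈ hv.linearIndepOn_id.extend (Set.subset_univ _) :=
      hv.linearIndepOn_id.subset_extend _ ⟨i, rfl⟩
    have := (Module.Basis.extend hv.linearIndepOn_id).constr_basis ℕ
      (fun x => if h : ∃ i, v i = x then w h.choose else 0) ⟨v i, hx⟩
    rw [Module.Basis.extend_apply_self] at this
    rw [this]
    have hex : ∃ j, v j = v i := ⟨i, rfl⟩
    rw [dif_pos hex, hv.injective hex.choose_spec]
  let g : Module.End (Module.End A M) M :=
    { toFun := f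
      map_add' := f.map_add
      map_smul' := by
        intro d m
        obtain ⟨c, rfl⟩ := hscal d
        simp }
  obtain ⟨r, hr⟩ := jacobson_density (R := A) (M := M) g (Finset.univ.image v)
  refine ⟨r, fun i => ?_⟩
  rw [← hf i]
  exact (hr (v i) (by simp)).symm

lemma SS_shift {A M : Type*} [Ring A] [AddCommGroup M] [Module A M] (u : ℕ → A) (V : ℕ → M)
    (N : ℕ)
    (h : ∀ j < N, ∀ c, u j • V c = if c = j + 1 then V j else 0) (c : ℕ) :
    ∀ (n : ℕ) (s : Finset ℕ), s ⊆ range N → #s = n →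
      SS u s • V c = if n ≤ c ∧ s = Ico (c - n) c then V (c - n) else 0 := by
  intro n
  induction n with
  | zero =>
    intro s _ hs
    rw [card_eq_zero] at hs
    subst hs
    simp
  | succ n ih =>
    intro s hsN hs
    rw [SS_rec _ _ (card_pos.1 (by omega)), Finset.sum_smul]
    have h1 : ∀ i ∈ s, (u i * SS u (s.erase i)) • V c =
        if n + 1 ≤ c ∧ s = Ico (c - (n + 1)) c ∧ i = c - (n + 1) then V i else 0 := by
      intro i hi
      rw [mul_smul, ih (s.erase i) ((erase_subset _ _).trans hsN)
        (by rw [card_erase_of_mem hi]; omega)]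
      by_cases hc : n ≤ c ∧ s.erase i = Ico (c - n) c
      · rw [if_pos hc, h i (by simpa using hsN hi)]
        by_cases hc2 : c - n = i + 1
        · rw [if_pos hc2, if_pos]
          refine ⟨by omega, ?_, by omega⟩
          rw [← insert_erase hi, hc.2]
          ext x
          simp only [mem_insert, mem_Ico]
          omega
        · rw [if_neg hc2, if_neg]
          rintro ⟨a1, a2, a3⟩
          omega
      · rw [if_neg hc, smul_zero, if_neg]
        rintro ⟨a1, a2, a3⟩
        apply hc
        refine ⟨by omega, ?_⟩
        rw [a2]
        ext x
        simp only [mem_erase, mem_Ico]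
        omega
    rw [Finset.sum_congr rfl h1]
    by_cases hc : n + 1 ≤ c ∧ s = Ico (c - (n + 1)) c
    · rw [if_pos hc, Finset.sum_eq_single (c - (n + 1))]
      · rw [if_pos ⟨hc.1, hc.2, rfl⟩]
      · intro b _ hb
        rw [if_neg]
        tauto
      · intro hb
        exfalso
        apply hb
        rw [hc.2, mem_Ico]
        omega
    · rw [if_neg hc]
      apply Finset.sum_eq_zero
      intro i _
      rw [if_neg]
      tauto

lemma PI_bound {K A M : Type*} [Field K] [IsAlgClosed K] [Uncountable K] [Ring A] [Algebra K A]
    [AddCommGroup M] [Module K M] [Module A M] [IsScalarTower K A M] [IsSimpleModule A M]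
    (hM : Module.rank K M ≤ Cardinal.aleph0) (Q : ℕ) (hQ : 2 ≤ Q)
    (hPI : ∀ a b : ℕ → A, SS a (range Q) * SS b (range Q) = SS b (range Q) * SS a (range Q))
    (v : Fin (2 * Q + 1) → M) (hv : LinearIndependent K v) : False := by
  set V : ℕ → M := fun i => if h : i < 2 * Q + 1 then v ⟨i, h⟩ else 0 with hV
  have h1 : ∀ j : ℕ, ∃ t : A, j < 2 * Q → ∀ c, t • V c = if c = j + 1 then V j else 0 := by
    intro j
    obtain ⟨t, ht⟩ := density (A := A) hM v hv
      (fun c => if (c : ℕ) = j + 1 then V j else 0)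
    refine ⟨t, fun hj c => ?_⟩
    by_cases hc : c < 2 * Q + 1
    · have := ht ⟨c, hc⟩
      simp only at this
      rw [← this]
      simp only [hV, dif_pos hc]
    · rw [if_neg (by omega)]
      simp only [hV, dif_neg hc, smul_zero]
  choose t ht using h1
  have e1 := SS_shift t V (2 * Q) (fun j hj => ht j hj)
  have e2 := SS_shift (fun i => t (Q + i)) (fun i => V (Q + i)) Q (by
    intro j hj c
    rw [ht (Q + j) (by omega)]
    simp only [add_assoc, Nat.add_left_cancel_iff])
  have hsub : range Q ⊆ range (2 * Q) := range_subset_range.2 (by omega)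
  have a1 := e1 Q Q (range Q) hsub (by simp)
  have a2 := e1 (Q + Q) Q (range Q) hsub (by simp)
  have a3 := e2 Q Q (range Q) (by simp) (by simp)
  rw [if_pos ⟨le_rfl, by ext x; simp⟩] at a1 a3
  rw [if_neg] at a2
  · have := congrArg (fun x => x • V (Q + Q)) (hPI t (fun i => t (Q + i)))
    simp only [mul_smul] at this
    rw [a2, a3] at this
    simp only [Nat.sub_self, add_zero, smul_zero] at this a1
    rw [a1] at this
    have h0 : V 0 = v ⟨0, by omega⟩ := by simp [hV]
    rw [h0] at this
    exact hv.ne_zero _ this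
  · rintro ⟨_, h⟩
    have : 0 ∈ Ico (Q + Q - Q) (Q + Q) := h ▸ (by simp; omega)
    simp at this
    omega

end WProof


namespace WProof
open Finset TensorProduct

lemma SS_extend {K A : Type*} [Field K] [Ring A] [Algebra K A] (Q : ℕ) (hQ : (Q : A) = 0)
    (hQ2 : 1 ≤ Q)
    (G : Set A) (h0 : (0 : A) ∈ G) (hG : Submodule.span K (insert 1 G) = ⊤)
    (N : Submodule K A) (h : ∀ a : ℕ → A, (∀ i, a i ∈ G) → SS a (range Q) ∈ N) :
    ∀ a : ℕ → A, SS a (range Q) ∈ N := by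
  have key : ∀ j ≤ Q, ∀ a : ℕ → A, (∀ i, j ≤ i → a i ∈ G) → SS a (range Q) ∈ N := by
    intro j
    induction j with
    | zero => intro _ a ha; exact h a fun i => ha i (Nat.zero_le i)
    | succ j ih =>
      intro hj a ha
      have hjr : j ∈ range Q := by simp; omega
      have aux : ∀ x ∈ Submodule.span K (insert 1 G), SS (Function.update a j x) (range Q) ∈ N := by
        intro x hx
        induction hx using Submodule.span_induction with
        | mem x hx =>
          rcases hx with rfl | hx
          · have := SS_insert_one (Function.update a j 1) (Q - 1) ((range Q).erase j) j
              (by rw [card_erase_of_mem hjr]; simp) (by simp) (by simp)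
            rw [insert_erase hjr, Nat.sub_add_cancel hQ2, hQ, zero_mul] at this
            rw [this]
            exact zero_mem _
          · apply ih (by omega)
            intro i hi
            by_cases hij : i = j
            · subst hij; simpa using hx
            · rw [Function.update_of_ne hij]
              exact ha i (by omega)
        | zero =>
          have := SS_update_smul (k := K) a j (range Q) hjr 0 0
          rw [zero_smul, zero_smul] at this
          rw [this]; exact zero_mem _
        | add x y _ _ h1 h2 => rw [SS_update_add a j _ hjr]; exact add_mem h1 h2
        | smul r x _ h1 => rw [SS_update_smul a j _ hjr]; exact N.smul_mem _ h1
      have := aux (a j) (hG ▸ Submodule.mem_top)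
      rwa [Function.update_eq_self] at this
  intro a
  have := key Q le_rfl (fun i => if i < Q then a i else 0) (by
    intro i hi
    rw [if_neg (by omega)]
    exact h0)
  rwa [SS_congr (b := a)] at this
  intro i hi
  simp at hi
  simp [hi]

variable {k R : Type*} [Field k] [Ring R] [Algebra k R] {Q : ℕ} {ε : R →ₐ[k] k}

lemma Ctx.PI_tensor (C : Ctx Q ε) (K : Type*) [Field K] [Algebra k K] (a b : ℕ → K ⊗[k] R) :
    SS a (range Q) * SS b (range Q) = SS b (range Q) * SS a (range Q) := by
  set G : Set (K ⊗[k] R) := {x | ∃ r : R, ε r = 0 ∧ x = 1 ⊗ₜ r} with hG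
  have h0 : (0 : K ⊗[k] R) ∈ G := ⟨0, by simp, by simp⟩
  have hQ : ((Q : ℕ) : K ⊗[k] R) = 0 := by
    have := congrArg (algebraMap k (K ⊗[k] R)) C.castQ
    simpa using this
  have hspan : Submodule.span K (insert 1 G) = ⊤ := by
    rw [eq_top_iff]
    rintro x -
    induction x using TensorProduct.induction_on with
    | zero => exact zero_mem _
    | add x y h1 h2 => exact add_mem h1 h2
    | tmul c r =>
      have e : c ⊗ₜ[k] r = c • ((1 : K) ⊗ₜ[k] (r - algebraMap k R (ε r))) +
          (c * algebraMap k K (ε r)) • (1 : K ⊗[k] R) := by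
        rw [Algebra.TensorProduct.one_def, TensorProduct.smul_tmul', TensorProduct.smul_tmul',
          TensorProduct.tmul_sub, smul_eq_mul, smul_eq_mul, mul_one, mul_one]
        rw [Algebra.algebraMap_eq_smul_one (A := R), ← TensorProduct.smul_tmul,
          Algebra.smul_def, mul_comm c]
        abel
      rw [e]
      refine add_mem (Submodule.smul_mem _ _ (Submodule.subset_span (Or.inr ⟨_, ?_, rfl⟩)))
        (Submodule.smul_mem _ _ (Submodule.subset_span (Or.inl rfl)))
      simp
  have hG' : ∀ a : ℕ → K ⊗[k] R, (∀ i, a i ∈ G) → ∃ a' : ℕ → R, (∀ i, ε (a' i) = 0) ∧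
      SS a (range Q) = Algebra.TensorProduct.includeRight (SS a' (range Q)) := by
    intro a ha
    choose a' h1 h2 using ha
    refine ⟨a', h1, ?_⟩
    have := SS_map ((Algebra.TensorProduct.includeRight : R →ₐ[k] K ⊗[k] R) : R →+* K ⊗[k] R)
      a' (range Q)
    simp only [RingHom.coe_coe] at this
    rw [this]
    congr 1
    ext i
    simp [h2]
  let Z : K ⊗[k] R → Submodule K (K ⊗[k] R) := fun z =>
    { carrier := {x | x * z = z * x}
      add_mem' := by intro x y hx hy; simp only [Set.mem_ofPred_eq] at *; rw [add_mul, mul_add, hx, hy]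
      zero_mem' := by simp
      smul_mem' := by
        intro c x hx; simp only [Set.mem_ofPred_eq] at *
        rw [smul_mul_assoc, mul_smul_comm, hx] }
  have hQ1 : 1 ≤ Q := by have := C.two_le; omega
  have s1 : ∀ b : ℕ → K ⊗[k] R, (∀ i, b i ∈ G) → ∀ a, SS a (range Q) ∈ Z (SS b (range Q)) := by
    intro b hb
    apply SS_extend Q hQ hQ1 G h0 hspan
    intro a ha
    obtain ⟨a', h1, h2⟩ := hG' a ha
    obtain ⟨b', h3, h4⟩ := hG' b hb
    change _ * _ = _ * _
    rw [h2, h4, ← map_mul, ← map_mul, C.SS_comm_ker a' b' h1 h3]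
  have s2 : ∀ b, SS b (range Q) ∈ Z (SS a (range Q)) := by
    apply SS_extend Q hQ hQ1 G h0 hspan
    intro b hb
    exact (s1 b hb a).symm
  exact (s2 b).symm

theorem Ctx.exists_rep (C : Ctx Q ε) (hR : Module.rank k R ≤ Cardinal.aleph0)
    (K : Type*) [Field K] [Algebra k K] [IsAlgClosed K] [Uncountable K]
    (a : R) (ha : ε a = 0) (ha0 : a ≠ 0) :
    ∃ n ≤ 2 * Q, ∃ ρ : R →ₐ[k] Matrix (Fin n) (Fin n) K,
      Submodule.span K (Set.range ρ) = ⊤ ∧ ρ a ≠ 0 := by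
  classical
  let S := K ⊗[k] R
  let inc : R →ₐ[k] S := Algebra.TensorProduct.includeRight
  have hinc : Function.Injective inc :=
    Algebra.TensorProduct.includeRight_injective (FaithfulSMul.algebraMap_injective k K)
  have hS : Module.rank K S ≤ Cardinal.aleph0 := by
    rw [Module.rank_baseChange]
    exact Cardinal.lift_le_aleph0.2 hR
  obtain ⟨m, hm, ham⟩ : ∃ m : Ideal S, m.IsMaximal ∧ inc a ∉ m := by
    by_contra hcon
    push Not at hcon
    have hJ : inc a ∈ Ring.jacobson S := by
      rw [Ring.jacobson_eq_sInf_isMaximal, Ideal.mem_sInf]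
      intro I hI
      exact hcon I hI
    apply ha0
    apply C.L3 a ha
    intro x y
    have h1 : inc (x * a * y) ∈ Ring.jacobson S := by
      rw [map_mul, map_mul]
      exact Ideal.mul_mem_right _ _ (Ideal.mul_mem_left _ _ hJ)
    obtain ⟨n, hn⟩ := nilpotent_of_jacobson hS _ h1
    refine ⟨n, hinc ?_⟩
    rw [map_pow, hn, map_zero]
  let M := S ⧸ m
  have hsimp : IsSimpleModule S M := isSimpleModule_iff_isCoatom.2 (Ideal.isMaximal_def.1 hm)
  have hM : Module.rank K M ≤ Cardinal.aleph0 :=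
    (LinearMap.rank_le_of_surjective (m.mkQ.restrictScalars K) m.mkQ_surjective).trans hS
  have hrk : Module.rank K M ≤ (2 * Q : ℕ) := by
    by_contra hcon
    push Not at hcon
    have h1 : ((2 * Q + 1 : ℕ) : Cardinal) ≤ Module.rank K M := by
      rw [← Cardinal.natCast_add_one_le_iff] at hcon
      exact_mod_cast hcon
    obtain ⟨s, hs, hli⟩ := le_rank_iff_exists_linearIndependent_finset.1 h1
    let e : Fin (2 * Q + 1) ≃ s := (s.equivFinOfCardEq hs).symm
    exact PI_bound (A := S) hM Q C.two_le (C.PI_tensor K) (fun i => (e i : M))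
      (hli.comp e e.injective)
  have hfin : Module.Finite K M :=
    Module.rank_lt_aleph0_iff.1 (hrk.trans_lt (Cardinal.natCast_lt_aleph0))
  have hn : Module.finrank K M ≤ 2 * Q := Module.finrank_le_of_rank_le hrk
  let b := Module.finBasis K M
  let φ : S →ₐ[K] Matrix (Fin (Module.finrank K M)) (Fin (Module.finrank K M)) K :=
    (LinearMap.toMatrixAlgEquiv b : _ →ₐ[K] _).comp (Algebra.lsmul K K M)
  have hφ : Function.Surjective φ := by
    intro A
    obtain ⟨s, hs⟩ := density (A := S) hM b b.linearIndependent
      (fun i => (LinearMap.toMatrixAlgEquiv b).symm A (b i))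
    refine ⟨s, ?_⟩
    have : Algebra.lsmul K K M s = (LinearMap.toMatrixAlgEquiv b).symm A := by
      apply b.ext
      intro i
      exact hs i
    simp only [φ, AlgHom.comp_apply]
    rw [this]
    simp
  refine ⟨Module.finrank K M, hn, (φ.restrictScalars k).comp inc, ?_, ?_⟩
  · rw [eq_top_iff]
    rintro A -
    obtain ⟨s, rfl⟩ := hφ A
    induction s using TensorProduct.induction_on with
    | zero => rw [map_zero]; exact zero_mem _
    | add x y h1 h2 => rw [map_add]; exact add_mem h1 h2
    | tmul c r =>
      have : c ⊗ₜ[k] r = c • inc r := by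
        change _ = c • ((1 : K) ⊗ₜ[k] r)
        rw [TensorProduct.smul_tmul', smul_eq_mul, mul_one]
      rw [this, map_smul]
      exact Submodule.smul_mem _ _ (Submodule.subset_span ⟨r, rfl⟩)
  · intro h
    apply ham
    have h1 : Algebra.lsmul K K M (inc a) = 0 := by
      have : (LinearMap.toMatrixAlgEquiv b) (Algebra.lsmul K K M (inc a)) = 0 := h
      simpa using this
    have h2 := congrArg (fun f => f (Submodule.Quotient.mk (1 : S) : M)) h1
    simp only [Algebra.lsmul_coe, LinearMap.zero_apply] at h2
    rw [← Submodule.Quotient.mk_smul, Submodule.Quotient.mk_eq_zero] at h2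
    simpa using h2

end WProof


namespace WProof
open Finset

section Capelli
variable (K : Type*) {A : Type*} [CommRing K] [Ring A] [Algebra K A] {m : ℕ}

/-- Capelli-type alternating product -/
noncomputable def altd (y : Fin m → A) : A [⋀^Fin m]→ₗ[K] A :=
  MultilinearMap.alternatization
    ((MultilinearMap.mkPiAlgebraFin K m A).compLinearMap fun l => LinearMap.mulLeft K (y l))

lemma altd_apply (y x : Fin m → A) : altd K y x =
    ∑ σ : Equiv.Perm (Fin m), Equiv.Perm.sign σ • (List.ofFn fun l => y l * x (σ l)).prod := by
  simp [altd, MultilinearMap.alternatization_apply, MultilinearMap.mkPiAlgebraFin_apply]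

lemma altd_map {k : Type*} [CommRing k] {R : Type*} [Ring R] [Algebra k R] [Algebra k A]
    (ρ : R →ₐ[k] A) (y x : Fin m → R) :
    ρ (altd k y x) = altd K (fun i => ρ (y i)) (fun i => ρ (x i)) := by
  rw [altd_apply, altd_apply, map_sum]
  apply Finset.sum_congr rfl
  intro σ _
  rw [Units.smul_def, Units.smul_def, map_zsmul, map_list_prod, List.map_ofFn]
  congr 3
  ext l
  simp

end Capelli

section
variable {K : Type*} [Field K]

lemma alt_eq_det {A : Type*} [AddCommGroup A] [Module K A] {m : ℕ}
    (B : Module.Basis (Fin m) K A) (f : A [⋀^Fin m]→ₗ[K] A) (v : Fin m → A) :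
    f v = B.det v • f B := by
  have : f = (LinearMap.toSpanSingleton K A (f B)).compAlternatingMap B.det := by
    apply Module.Basis.ext_alternating B
    intro w hw
    let σ : Equiv.Perm (Fin m) := Equiv.ofBijective w (Finite.injective_iff_bijective.1 hw)
    have h1 : (fun i => B (w i)) = (B : Fin m → A) ∘ σ := rfl
    rw [h1, AlternatingMap.map_perm, AlternatingMap.map_perm]
    simp [Module.Basis.det_self]
  conv_lhs => rw [this]
  simp

lemma alt_update {A : Type*} [AddCommGroup A] [Module K A] {m : ℕ}
    (B : Module.Basis (Fin m) K A) (f : A [⋀^Fin m]→ₗ[K] A) (j : Fin m) (r : A) :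
    f (Function.update B j r) = B.repr r j • f B := by
  conv_lhs => rw [← B.sum_repr r]
  rw [AlternatingMap.map_update_sum, Finset.sum_eq_single j]
  · rw [AlternatingMap.map_update_smul, Function.update_eq_self]
  · intro i _ hi
    rw [AlternatingMap.map_update_smul, AlternatingMap.map_update_self _ _ hi.symm, smul_zero]
  · simp

lemma single_prod {ι : Type*} [Fintype ι] [DecidableEq ι] : ∀ (M : ℕ) (p c : Fin (M + 1) → ι),
    (List.ofFn fun l => (Matrix.single (p l) (c l) 1 : Matrix ι ι K)).prod =
      if ∀ l : Fin M, c l.castSucc = p l.succ then Matrix.single (p 0) (c (Fin.last M)) 1 else 0 := by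
  intro M
  induction M with
  | zero => intro p c; simp
  | succ M ih =>
    intro p c
    rw [List.ofFn_succ', List.concat_eq_append, List.prod_append, List.prod_singleton]
    have := ih (fun l => p l.castSucc) (fun l => c l.castSucc)
    rw [this]
    by_cases h1 : ∀ l : Fin M, c l.castSucc.castSucc = p l.succ.castSucc
    · rw [if_pos h1]
      by_cases h2 : c (Fin.last M).castSucc = p (Fin.last (M + 1))
      · rw [if_pos, h2, Matrix.single_mul_single_same]
        · simp
        · intro l
          refine Fin.lastCases ?_ (fun l => ?_) l
          · exact h2
          · exact h1 l
      · rw [if_neg, Matrix.single_mul_single_of_ne]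
        · exact h2
        · intro h
          exact h2 (h (Fin.last M))
    · rw [if_neg h1, if_neg, zero_mul]
      intro h
      apply h1
      intro l
      exact h l.castSucc

lemma altd_std_ne {ι : Type*} [Fintype ι] [DecidableEq ι] (M : ℕ) (e : Fin (M + 1) ≃ ι × ι) :
    ∃ y : Fin (M + 1) → Matrix ι ι K,
      altd K y (fun l => Matrix.single (e l).1 (e l).2 1) ≠ 0 := by
  let p : Fin (M + 1) → ι := Fin.cons (e 0).1 (fun l => (e l.castSucc).2)
  refine ⟨fun l => Matrix.single (p l) (e l).1 1, ?_⟩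
  rw [altd_apply, Finset.sum_eq_single 1]
  · have h1 : ∀ l, Matrix.single (p l) (e l).1 (1 : K) *
        Matrix.single (e ((1 : Equiv.Perm (Fin (M + 1))) l)).1
          (e ((1 : Equiv.Perm (Fin (M + 1))) l)).2 1 = Matrix.single (p l) (e l).2 1 := by
      intro l
      simp
    simp only [h1]
    rw [single_prod, if_pos]
    · simp only [Equiv.Perm.sign_one, one_smul]
      intro h
      have := congrFun (congrFun h (p 0)) (e (Fin.last M)).2
      simp at this
    · intro l
      simp [p]
  · intro σ _ hσ
    by_cases h : ∀ l, (e l).1 = (e (σ l)).1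
    · have h1 : ∀ l, Matrix.single (p l) (e l).1 (1 : K) *
          Matrix.single (e (σ l)).1 (e (σ l)).2 1 = Matrix.single (p l) (e (σ l)).2 1 := by
        intro l
        rw [h l]
        simp
      simp only [h1]
      rw [single_prod, if_neg, smul_zero]
      intro hc
      apply hσ
      have hfix : ∀ l : Fin M, σ l.castSucc = l.castSucc := by
        intro l
        have := hc l
        simp only [p, Fin.cons_succ] at this
        exact e.injective (Prod.ext (h _).symm this)
      ext l
      refine congrArg Fin.val ?_
      refine Fin.lastCases ?_ (fun l => hfix l) l
      rcases Fin.eq_castSucc_or_eq_last (σ (Fin.last M)) with ⟨j, hj⟩ | hj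
      · exfalso
        rw [← hfix j] at hj
        have := σ.injective hj
        exact (Fin.castSucc_lt_last j).ne' this
      · exact hj
    · push Not at h
      obtain ⟨l, hl⟩ := h
      rw [List.prod_eq_zero, smul_zero]
      rw [List.mem_ofFn]
      exact ⟨l, Matrix.single_mul_single_of_ne _ _ _ _ hl _⟩
  · simp

/-- nonvanishing with y in a spanning set -/
lemma altd_ne {ι : Type*} [Fintype ι] [DecidableEq ι] (M : ℕ) (e : Fin (M + 1) ≃ ι × ι)
    (b : Module.Basis (Fin (M + 1)) K (Matrix ι ι K)) (G : Set (Matrix ι ι K))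
    (hG : Submodule.span K G = ⊤) :
    ∃ y : Fin (M + 1) → Matrix ι ι K, (∀ l, y l ∈ G) ∧ altd K y b ≠ 0 := by
  by_contra hcon
  push Not at hcon
  obtain ⟨y, hy⟩ := altd_std_ne (K := K) M e
  apply hy
  rw [alt_eq_det b (altd K y)]
  let F : MultilinearMap K (fun _ : Fin (M + 1) => Matrix ι ι K) (Matrix ι ι K) :=
    ∑ σ : Equiv.Perm (Fin (M + 1)), ((Equiv.Perm.sign σ : ℤˣ) : ℤ) •
      (MultilinearMap.mkPiAlgebraFin K (M + 1) (Matrix ι ι K)).compLinearMap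
        (fun l => LinearMap.mulRight K (b (σ l)))
  have hF : ∀ y, F y = altd K y b := by
    intro y
    rw [altd_apply]
    simp [F, MultilinearMap.mkPiAlgebraFin_apply, Units.smul_def]
  have hF0 : F = 0 := by
    let b' := Module.Basis.ofSpan hG.ge
    apply Module.Basis.ext_multilinear (fun _ => b')
    intro v
    rw [hF]
    simp only [MultilinearMap.zero_apply]
    apply hcon
    intro l
    exact Module.Basis.ofSpan_subset hG.ge ⟨v l, rfl⟩
  rw [← hF, hF0]
  simp

end
end WProof


namespace WProof
open Finset

section Eigen
variable {k R : Type*} [Field k] [Ring R] [Algebra k R] {Q : ℕ} {ε : R →ₐ[k] k}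
variable {K : Type*} [Field K] {I : Type*} {A : I → Type*} [∀ i, Ring (A i)] [∀ i, Algebra K (A i)]
  [∀ i, Algebra k (A i)]

lemma Ctx.eigen_aux (C : Ctx Q ε) (ρ : ∀ i, R →ₐ[k] A i)
    (hsep : ∀ r, ε r = 0 → (∀ i, ρ i r = 0) → r = 0) (c : I → K)
    (ψ r1 r2 r4 : R) (h0 : ε ψ = 0) (h1 : ε r1 = 0) (h2 : ε r2 = 0) (h4 : ε r4 = 0)
    (H1 : ∀ i, ρ i r1 = c i • ρ i ψ) (H2 : ∀ i, ρ i r2 = c i ^ (Q ^ 2) • ρ i ψ)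
    (H4 : ∀ i, ρ i r4 = c i ^ (Q ^ 4) • ρ i ψ) : r2 - r1 ∈ Wm Q ε := by
  have sep : ∀ x y, ε x = 0 → ε y = 0 → (∀ i, ρ i x = ρ i y) → x = y := by
    intro x y hx hy h
    rw [← sub_eq_zero]
    apply hsep
    · simp [hx, hy]
    · intro i; simp [h i]
  have hQ := C.two_le
  have hQ24 : Q ^ 2 + 1 ≤ Q ^ 4 := by nlinarith [Nat.mul_le_mul hQ hQ, Nat.mul_le_mul (Nat.mul_le_mul hQ hQ) (Nat.mul_le_mul hQ hQ)]
  obtain ⟨d, hd⟩ := Nat.exists_eq_add_of_le hQ24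
  have c1 : Commute r4 ψ := by
    apply sep <;> simp [h0, h4, H4]
  have hQ4 : Q ^ 4 ≠ 0 := by positivity
  have hQ2 : Q ^ 2 ≠ 0 := by positivity
  have h22 : (Q ^ 2) ^ 2 = Q ^ 4 := by ring
  have e1 : r1 ^ ((Q ^ 2) ^ 2) = (r4 * ψ ^ d) * ψ ^ (Q ^ 2) := by
    rw [h22]
    apply sep
    · simp [h1, C.Qne]
    · simp [h4]
    · intro i
      simp only [map_pow, map_mul, H1, H4, smul_pow]
      rw [smul_mul_assoc, smul_mul_assoc]
      congr 1
      rw [← pow_succ', ← pow_add]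
      congr 1
      omega
  have e2 : r2 ^ ((Q ^ 2) ^ 2) = ψ ^ (d + 1) * r4 ^ (Q ^ 2) := by
    rw [h22]
    apply sep
    · simp [h2, C.Qne]
    · simp [h0]
    · intro i
      simp only [map_pow, map_mul, H2, H4, smul_pow]
      rw [mul_smul_comm]
      rw [← pow_add, ← pow_mul, ← pow_mul, mul_comm (Q ^ 2)]
      congr 2
      omega
  have m1 := C.Ltwo_c r1 h1 2
  have m2 := C.Ltwo_c r2 h2 2
  have m3 := C.Ltwo_b (r4 * ψ ^ d) ψ (by simp [h4]) h0 (by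
    exact c1.mul_left (Commute.pow_self ψ d))
  have m4 := C.Ltwo_b (ψ ^ (d + 1)) r4 (by simp [h0]) h4 (c1.symm.pow_left _)
  rw [e1] at m1
  rw [e2] at m2
  have e3 : ψ ^ (d + 1) * r4 = r4 * ψ ^ d * ψ := by
    rw [mul_assoc, ← pow_succ, (c1.symm.pow_left (d+1)).eq]
  rw [e3] at m4
  have := sub_mem (sub_mem (add_mem m2 m3) m1) m4
  convert this using 1
  abel

lemma Ctx.eigen (C : Ctx Q ε) (ρ : ∀ i, R →ₐ[k] A i)
    (hsep : ∀ r, ε r = 0 → (∀ i, ρ i r = 0) → r = 0) (c : I → K) (i0 : I)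
    (hprime : ∀ a b, ρ i0 a ≠ 0 → ρ i0 b ≠ 0 → ∃ r, ρ i0 (a * r * b) ≠ 0)
    (e e' : R) (he : ε e = 0) (he' : ε e' = 0) (h : ∀ i, ρ i e' = c i • ρ i e)
    (hne : ρ i0 e ≠ 0) : c i0 ^ (Q ^ 2) = c i0 := by
  have key : ∀ N : ℕ, ∃ ψ : R, ε ψ = 0 ∧ ρ i0 ψ ≠ 0 ∧
      ∀ j ≤ N, ∃ b, ε b = 0 ∧ ∀ i, ρ i b = c i ^ j • ρ i ψ := by
    intro N
    induction N with
    | zero =>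
      refine ⟨e, he, hne, fun j hj => ⟨e, he, fun i => ?_⟩⟩
      obtain rfl : j = 0 := by omega
      simp
    | succ N ih =>
      obtain ⟨ψ, h1, h2, h3⟩ := ih
      obtain ⟨r, hr⟩ := hprime ψ e h2 hne
      refine ⟨ψ * r * e, by simp [he], hr, fun j hj => ?_⟩
      rcases Nat.lt_or_ge N j with hj' | hj'
      · obtain rfl : j = N + 1 := by omega
        obtain ⟨b, hb, hb'⟩ := h3 N le_rfl
        refine ⟨b * r * e', by simp [he'], fun i => ?_⟩
        rw [map_mul, map_mul, hb', h, map_mul, map_mul, smul_mul_assoc, smul_mul_assoc,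
          mul_smul_comm, smul_smul, pow_succ]
      · obtain ⟨b, hb, hb'⟩ := h3 j hj'
        refine ⟨b * r * e, by simp [he], fun i => ?_⟩
        rw [map_mul, map_mul, hb', map_mul, map_mul, smul_mul_assoc, smul_mul_assoc]
  obtain ⟨ψ, h1, h2, h3⟩ := key (Q ^ 4)
  have hQ := C.two_le
  have hQ24 : Q ^ 2 ≤ Q ^ 4 := Nat.pow_le_pow_right (by omega) (by omega)
  obtain ⟨r1, g1, G1⟩ := h3 1 (Nat.one_le_pow _ _ (by omega))
  obtain ⟨r2, g2, G2⟩ := h3 (Q ^ 2) hQ24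
  obtain ⟨r4, g4, G4⟩ := h3 (Q ^ 4) le_rfl
  have hz : r2 - r1 = 0 := by
    apply C.H
    intro a b
    have := C.eigen_aux ρ hsep c (a * ψ * b) (a * r1 * b) (a * r2 * b) (a * r4 * b)
      (by simp [h1]) (by simp [g1]) (by simp [g2]) (by simp [g4])
      (by intro i; simp [G1]) (by intro i; simp [G2]) (by intro i; simp [G4])
    convert this using 1
    noncomm_ring
  have h5 : ρ i0 r2 = ρ i0 r1 := by rw [sub_eq_zero.1 hz]
  rw [G2, G1, pow_one, ← sub_eq_zero, ← sub_smul, smul_eq_zero] at h5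
  exact sub_eq_zero.1 (h5.resolve_right h2)

end Eigen

section Fam
variable {k R : Type*} [Field k] [Ring R] [Algebra k R] {Q : ℕ} {ε : R →ₐ[k] k}
variable (K : Type*) [Field K] [Algebra k K]

/-- family of absolutely irreducible representations of bounded degree -/
structure Fam (Q : ℕ) (k R K : Type*) [Field k] [Ring R] [Algebra k R] [Field K] [Algebra k K] where
  n : ℕ
  hn : n ≤ 2 * Q
  ρ : R →ₐ[k] Matrix (Fin n) (Fin n) K
  span : Submodule.span K (Set.range ρ) = ⊤

variable {K}

lemma mat_prime {n : ℕ} (ρ : R →ₐ[k] Matrix (Fin n) (Fin n) K)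
    (hs : Submodule.span K (Set.range ρ) = ⊤) (a b : R) (ha : ρ a ≠ 0) (hb : ρ b ≠ 0) :
    ∃ r, ρ (a * r * b) ≠ 0 := by
  by_contra hcon
  push Not at hcon
  have h1 : ∀ x : Matrix (Fin n) (Fin n) K, ρ a * x * ρ b = 0 := by
    intro x
    have hx : x ∈ Submodule.span K (Set.range ρ) := hs ▸ Submodule.mem_top
    induction hx using Submodule.span_induction with
    | mem x hx => obtain ⟨r, rfl⟩ := hx; rw [← map_mul, ← map_mul]; exact hcon r
    | zero => simp
    | add x y _ _ hx hy => rw [mul_add, add_mul, hx, hy, add_zero]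
    | smul c x _ hx => rw [mul_smul_comm, smul_mul_assoc, hx, smul_zero]
  have : ∃ i j, ρ a i j ≠ 0 := by
    by_contra h; push Not at h; exact ha (by ext i j; simp [h])
  obtain ⟨i, j, hij⟩ := this
  have : ∃ i j, ρ b i j ≠ 0 := by
    by_contra h; push Not at h; exact hb (by ext i j; simp [h])
  obtain ⟨i', j', hij'⟩ := this
  have h2 := congrFun (congrFun (h1 (Matrix.single j i' 1)) i) j'
  rw [Matrix.mul_apply, Finset.sum_eq_single i'] at h2
  · rw [Matrix.mul_single_apply_same] at h2
    simp [hij, hij'] at h2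
  · intro l _ hl
    rw [Matrix.mul_single_apply_of_ne _ _ _ _ _ hl]
    simp
  · simp

/-- a K-span of a two-sided nonzero ideal's image is everything -/
lemma mat_ideal {n : ℕ} (ρ : R →ₐ[k] Matrix (Fin n) (Fin n) K)
    (hs : Submodule.span K (Set.range ρ) = ⊤) (S : Set R)
    (hS : ∀ s ∈ S, ∀ a b, a * s * b ∈ S) (s : R) (hsS : s ∈ S) (hne : ρ s ≠ 0) :
    Submodule.span K (ρ '' S) = ⊤ := by
  have hl : ∀ (z : R) (x : Matrix (Fin n) (Fin n) K) (c : R), x * ρ (z) * ρ c ∈ Submodule.span K (ρ '' S) ∨ z ∉ S := by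
    intro z x c
    by_cases hz : z ∈ S
    swap
    · right; exact hz
    left
    have hx : x ∈ Submodule.span K (Set.range ρ) := hs ▸ Submodule.mem_top
    induction hx using Submodule.span_induction with
    | mem x hx => obtain ⟨r, rfl⟩ := hx; rw [← map_mul, ← map_mul]; exact Submodule.subset_span ⟨_, hS z hz r c, rfl⟩
    | zero => simp
    | add x y _ _ hx hy => rw [add_mul, add_mul]; exact add_mem hx hy
    | smul c x _ hx => rw [smul_mul_assoc, smul_mul_assoc]; exact Submodule.smul_mem _ _ hx
  have h2 : ∀ x y : Matrix (Fin n) (Fin n) K, x * ρ s * y ∈ Submodule.span K (ρ '' S) := by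
    intro x y
    have hy : y ∈ Submodule.span K (Set.range ρ) := hs ▸ Submodule.mem_top
    induction hy using Submodule.span_induction with
    | mem y hy => obtain ⟨r, rfl⟩ := hy; exact (hl s x r).resolve_right (by simpa using hsS)
    | zero => simp
    | add y z _ _ hx hy => rw [mul_add]; exact add_mem hx hy
    | smul c x _ hx => rw [mul_smul_comm]; exact Submodule.smul_mem _ _ hx
  have : ∃ i j, ρ s i j ≠ 0 := by
    by_contra h; push Not at h; exact hne (by ext i j; simp [h])
  obtain ⟨i, j, hij⟩ := this
  rw [eq_top_iff]
  intro x _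
  rw [Matrix.matrix_eq_sum_single x]
  refine Submodule.sum_mem _ fun p _ => Submodule.sum_mem _ fun q _ => ?_
  have := h2 (Matrix.single p i (x p q / ρ s i j)) (Matrix.single j q 1)
  convert this using 1
  rw [Matrix.single_mul_mul_single]
  simp [hij]

end Fam
end WProof


namespace WProof
open Finset

lemma altd_zero_left {K A : Type*} [CommRing K] [Ring A] [Algebra K A] {M : ℕ}
    (y x : Fin (M + 1) → A) (hy : ∀ l, y l = 0) : altd K y x = 0 := by
  rw [altd_apply]
  apply Finset.sum_eq_zero
  intro σ _
  rw [List.prod_eq_zero, smul_zero]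
  rw [List.mem_ofFn]
  exact ⟨0, by simp [hy]⟩

variable {k R : Type*} [Field k] [Ring R] [Algebra k R] {Q : ℕ} {ε : R →ₐ[k] k}
variable {K : Type*} [Field K] [Algebra k K]

lemma Ctx.coords (C : Ctx Q ε)
    (hsep : ∀ r, ε r = 0 → (∀ f : Fam Q k R K, f.ρ r = 0) → r = 0) (f0 : Fam Q k R K)
    (s : R) (hs : ε s = 0) (hsK : ∀ f : Fam Q k R K, f0.n < f.n → f.ρ s = 0)
    (hne : f0.ρ s ≠ 0) (M : ℕ) (hM : f0.n * f0.n = M + 1) :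
    ∃ b : Module.Basis (Fin (M + 1)) K (Matrix (Fin f0.n) (Fin f0.n) K),
      (∀ l, ∃ x, f0.ρ x = b l) ∧ ∀ r j, (b.repr (f0.ρ r) j) ^ (Q ^ 2) = b.repr (f0.ρ r) j := by
  let S : Set R := {r | ε r = 0 ∧ ∀ f : Fam Q k R K, f0.n < f.n → f.ρ r = 0}
  have hspan := mat_ideal f0.ρ f0.span S (by
    rintro t ⟨h1, h2⟩ a b
    exact ⟨by simp [h1], fun f hf => by simp [h2 f hf]⟩) s ⟨hs, hsK⟩ hne
  let ee : ∀ n : ℕ, n * n = M + 1 → (Fin (M + 1) ≃ Fin n × Fin n) := fun n hn =>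
    (finCongr hn.symm).trans finProdFinEquiv.symm
  let b' := Module.Basis.ofSpan f0.span.ge
  let b : Module.Basis (Fin (M + 1)) K (Matrix (Fin f0.n) (Fin f0.n) K) :=
    b'.reindex ((b'.indexEquiv (Matrix.stdBasis K (Fin f0.n) (Fin f0.n))).trans (ee f0.n hM).symm)
  have hb : ∀ l, ∃ x, f0.ρ x = b l := by
    intro l
    have : b l ∈ Set.range b' := by simp [b]
    exact Module.Basis.ofSpan_subset f0.span.ge this
  have hb' := hb
  choose x hx using hb
  obtain ⟨y, hyS, hy⟩ := altd_ne M (ee f0.n hM) b _ hspan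
  choose y' hy'S hy' using hyS
  refine ⟨b, hb', fun r j => ?_⟩
  have hmem : ∀ z : Fin (M + 1) → R, altd k y' z ∈ S := by
    intro z
    constructor
    · rw [altd_map k ε]
      exact altd_zero_left _ _ fun l => (hy'S l).1
    · intro f hf
      rw [altd_map K f.ρ]
      exact altd_zero_left _ _ fun l => (hy'S l).2 f hf
  set e := altd k y' x with he
  set e' := altd k y' (Function.update x j r) with he'
  have hρe : f0.ρ e = altd K y b := by
    rw [he, altd_map K f0.ρ]
    simp only [hx, hy']
  have hρe' : f0.ρ e' = b.repr (f0.ρ r) j • f0.ρ e := by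
    rw [hρe, ← alt_update, he', altd_map K f0.ρ]
    simp only [hy']
    congr 1
    ext1 l
    by_cases hl : l = j
    · subst hl; simp
    · simp [hl, hx]
  obtain ⟨t, ht⟩ := mat_prime f0.ρ f0.span e e (hρe ▸ hy) (hρe ▸ hy)
  have hc : ∀ f : Fam Q k R K, ∃ c : K, f.ρ (e * t * e') = c • f.ρ (e * t * e) := by
    intro f
    rcases lt_trichotomy f.n f0.n with h | h | h
    · refine ⟨0, ?_⟩
      have : f.ρ e = 0 := by
        rw [he, altd_map K f.ρ]
        apply AlternatingMap.map_linearDependent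
        intro hli
        have h1 := hli.fintype_card_le_finrank
        rw [Module.finrank_matrix] at h1
        simp only [Fintype.card_fin, Module.finrank_self, mul_one] at h1
        rw [← hM] at h1
        have := Nat.mul_lt_mul'' h h
        omega
      simp [this]
    · have hM' : f.n * f.n = M + 1 := by rw [h, hM]
      let B : Module.Basis (Fin (M + 1)) K (Matrix (Fin f.n) (Fin f.n) K) :=
        (Matrix.stdBasis K (Fin f.n) (Fin f.n)).reindex (ee f.n hM').symm
      obtain ⟨Φ, D, hD⟩ : ∃ Φ, ∃ D : (Fin (M + 1) → R) → K, ∀ z, f.ρ (altd k y' z) = D z • Φ := by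
        refine ⟨altd K (fun i => f.ρ (y' i)) B, fun z => B.det (fun i => f.ρ (z i)), fun z => ?_⟩
        rw [altd_map K f.ρ, alt_eq_det B]
      by_cases h0 : D x = 0
      · refine ⟨0, ?_⟩
        have : f.ρ e = 0 := by rw [he, hD, h0, zero_smul]
        simp [this]
      · refine ⟨D (Function.update x j r) / D x, ?_⟩
        have : f.ρ e' = (D (Function.update x j r) / D x) • f.ρ e := by
          rw [he, he', hD, hD, smul_smul, div_mul_cancel₀ _ h0]
        rw [map_mul, this, map_mul _ _ e, mul_smul_comm]
    · refine ⟨0, ?_⟩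
      have : f.ρ e = 0 := (hmem x).2 f h
      simp [this]
  choose c hc using hc
  have h1 := C.eigen (I := Fam Q k R K) (fun f => f.ρ) hsep c f0 (mat_prime f0.ρ f0.span)
    (e * t * e) (e * t * e') (by simp [(hmem x).1, he]) (by simp [(hmem x).1, he]) hc ht
  have h2 : c f0 = b.repr (f0.ρ r) j := by
    have h3 := hc f0
    rw [map_mul, hρe', mul_smul_comm, ← map_mul, ← sub_eq_zero, ← sub_smul, smul_eq_zero] at h3
    exact (sub_eq_zero.1 (h3.resolve_right ht)).symm
  rwa [h2] at h1

end WProof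


namespace WProof
open Finset

variable {k R : Type*} [Field k] [Ring R] [Algebra k R] {Q : ℕ} {ε : R →ₐ[k] k}

lemma finite_fix (K : Type*) [Field K] (N : ℕ) (hN : 2 ≤ N) : Finite {c : K // c ^ N = c} := by
  have h0 : (Polynomial.X ^ N - Polynomial.X : Polynomial K) ≠ 0 := by
    intro h
    have := congrArg (fun p => Polynomial.coeff p N) h
    simp only [Polynomial.coeff_sub, Polynomial.coeff_X_pow, Polynomial.coeff_X, if_true,
      if_neg (show ¬ 1 = N by omega), Polynomial.coeff_zero, sub_zero] at this
    exact one_ne_zero this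
  apply Set.Finite.subset ((Polynomial.X ^ N - Polynomial.X : Polynomial K).rootSet_finite K)
  intro c hc
  rw [Polynomial.mem_rootSet]
  refine ⟨h0, ?_⟩
  have : c ^ N = c := hc
  simp [this]

lemma finite_homs (π : FreeAlgebra k (Fin 2) →ₐ[k] R) (hπ : Function.Surjective π)
    (K : Type*) [Field K] [Algebra k K] (N : ℕ) (hN : 2 ≤ N) (M : ℕ) :
    Finite {φ : R →ₐ[k] Matrix (Fin M) (Fin M) K // ∀ r i j, (φ r i j) ^ N = φ r i j} := by
  have := finite_fix K N hN
  apply Finite.of_injective (β := Fin 2 → Fin M → Fin M → {c : K // c ^ N = c})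
    (fun φ l i j => ⟨φ.1 (π (FreeAlgebra.ι k l)) i j, φ.2 _ i j⟩)
  intro φ φ' h
  apply Subtype.ext
  have h1 : φ.1.comp π = φ'.1.comp π := by
    apply FreeAlgebra.hom_ext
    ext l i j
    have := congrFun (congrFun (congrFun h l) i) j
    exact congrArg Subtype.val this
  ext1 r
  obtain ⟨a, rfl⟩ := hπ r
  exact DFunLike.congr_fun h1 a

theorem Ctx.finite [Finite k] (C : Ctx Q ε) (π : FreeAlgebra k (Fin 2) →ₐ[k] R)
    (hπ : Function.Surjective π) : Finite R := by
  have hR : Module.rank k R ≤ Cardinal.aleph0 := by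
    have h1 := LinearMap.lift_rank_le_of_surjective π.toLinearMap hπ
    have h2 : Module.rank k (FreeAlgebra k (Fin 2)) ≤ Cardinal.aleph0 := by
      rw [FreeAlgebra.rank_eq]
      simp
    rw [← Cardinal.lift_le_aleph0] at h2
    exact Cardinal.lift_le_aleph0.1 (h1.trans h2)
  let K := AlgebraicClosure (FractionRing (MvPolynomial (ℕ → Bool) k))
  have hK : Uncountable K := by
    have : Function.Injective (fun s : ℕ → Bool => algebraMap (FractionRing (MvPolynomial (ℕ → Bool) k)) K
        (algebraMap (MvPolynomial (ℕ → Bool) k) _ (MvPolynomial.X s))) := by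
      intro s t h
      have h1 := (algebraMap (FractionRing (MvPolynomial (ℕ → Bool) k)) K).injective h
      have h2 := IsFractionRing.injective (MvPolynomial (ℕ → Bool) k)
        (FractionRing (MvPolynomial (ℕ → Bool) k)) h1
      exact MvPolynomial.X_injective h2
    have h3 : Uncountable (ℕ → Bool) := by
      rw [← Cardinal.aleph0_lt_mk_iff]
      simpa using Cardinal.cantor Cardinal.aleph0
    exact this.uncountable
  have hsep : ∀ r, ε r = 0 → (∀ f : Fam Q k R K, f.ρ r = 0) → r = 0 := by
    intro r hr h
    by_contra h0
    obtain ⟨n, hn, ρ, h1, h2⟩ := C.exists_rep hR K r hr h0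
    exact h2 (h ⟨n, hn, ρ, h1⟩)
  have hQ := C.two_le
  have hQ2 : 2 ≤ Q ^ 2 := by nlinarith
  have key : ∀ r, ε r = 0 → (∀ M ≤ (2 * Q) * (2 * Q), ∀ φ : R →ₐ[k] Matrix (Fin M) (Fin M) K,
      (∀ r i j, (φ r i j) ^ (Q ^ 2) = φ r i j) → φ r = 0) → r = 0 := by
    intro r hr h
    by_contra h0
    have hex : ∃ f : Fam Q k R K, f.ρ r ≠ 0 := by
      by_contra hcon
      push Not at hcon
      exact h0 (hsep r hr hcon)
    classical
    have hexn : ∃ n, n ≤ 2 * Q ∧ (∃ f : Fam Q k R K, f.n = n ∧ f.ρ r ≠ 0) := by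
      obtain ⟨f, hf⟩ := hex
      exact ⟨f.n, f.hn, f, rfl, hf⟩
    obtain ⟨f, hf, hmax⟩ : ∃ f : Fam Q k R K, f.ρ r ≠ 0 ∧ ∀ g : Fam Q k R K, f.n < g.n → g.ρ r = 0 := by
      obtain ⟨n, hn, f, hfn, hf⟩ := hexn
      obtain ⟨f, hf, hfm⟩ := Nat.findGreatest_spec (P := fun n => ∃ f : Fam Q k R K, f.n = n ∧ f.ρ r ≠ 0) hn ⟨f, hfn, hf⟩
      refine ⟨f, hfm, fun g hg => ?_⟩
      by_contra hg0
      have := Nat.le_findGreatest (P := fun n => ∃ f : Fam Q k R K, f.n = n ∧ f.ρ r ≠ 0) g.hn ⟨g, rfl, hg0⟩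
      omega
    have hn0 : f.n ≠ 0 := by
      intro hn0
      apply hf
      ext i
      exact absurd i.2 (by omega)
    obtain ⟨M, hM⟩ : ∃ M, f.n * f.n = M + 1 := Nat.exists_eq_succ_of_ne_zero (by positivity)
    obtain ⟨b, hb, hc⟩ := C.coords hsep f r hr hmax hf M hM
    have h1 := h (M + 1) (by rw [← hM]; exact Nat.mul_le_mul f.hn f.hn)
      (((Algebra.leftMulMatrix b).restrictScalars k).comp f.ρ) (by
        intro r i j
        obtain ⟨x, hx⟩ := hb j
        have : (((Algebra.leftMulMatrix b).restrictScalars k).comp f.ρ) r i j =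
            b.repr (f.ρ (r * x)) i := by
          rw [map_mul, hx]
          simp [Algebra.leftMulMatrix_eq_repr_mul]
        rw [this]
        exact hc _ _)
    apply hf
    apply Algebra.leftMulMatrix_injective b
    rw [map_zero]
    exact h1
  have := fun M : Fin (2 * Q * (2 * Q) + 1) => finite_homs π hπ K (Q ^ 2) hQ2 M
  have := finite_fix K (Q ^ 2) hQ2
  apply Finite.of_injective (β := k × (∀ M : Fin (2 * Q * (2 * Q) + 1),
    {φ : R →ₐ[k] Matrix (Fin M) (Fin M) K // ∀ r i j, (φ r i j) ^ (Q ^ 2) = φ r i j} →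
      Fin M → Fin M → {c : K // c ^ (Q ^ 2) = c}))
    (fun r => (ε r, fun M φ i j => ⟨φ.1 r i j, φ.2 r i j⟩))
  intro r r' h
  rw [Prod.ext_iff] at h
  obtain ⟨h1, h2⟩ := h
  rw [← sub_eq_zero]
  apply key
  · rw [map_sub, sub_eq_zero]; exact h1
  · intro M hM φ hφ
    rw [map_sub, sub_eq_zero]
    ext i j
    exact congrArg Subtype.val (congrFun (congrFun (congrFun (congrFun h2 ⟨M, by omega⟩) ⟨φ, hφ⟩) i) j)

end WProof


namespace WProof
open Finset

section FF
lemma dich {E : Type*} [Field E] [Finite E] (p : ℕ) [Fact p.Prime] [CharP E p] (m : ℕ) :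
    (∀ a : E, (a ^ p ^ m) ^ p ^ m = a) ∨
      ∀ G : AddSubgroup E, (∀ a : E, a ^ (p ^ m + 1) ∈ G) → ∀ a, a ∈ G := by
  classical
  by_cases h : ∀ a : E, (a ^ p ^ m) ^ p ^ m = a
  · exact Or.inl h
  right
  push Not at h
  obtain ⟨a, ha⟩ := h
  intro G hG
  have frob : ∀ x y : E, (x + y) ^ p ^ m = x ^ p ^ m + y ^ p ^ m := fun x y => add_pow_char_pow x y p m
  let s : Submonoid E := MonoidHom.mrange (powMonoidHom (p ^ m + 1))
  let V : Subring E := Subring.closure s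
  have hVG : ∀ x ∈ V, x ∈ G := by
    intro x hx
    rw [Subring.mem_closure_iff, Submonoid.closure_eq] at hx
    have : AddSubgroup.closure (s : Set E) ≤ G := by
      rw [AddSubgroup.closure_le]
      rintro _ ⟨y, rfl⟩
      exact hG y
    exact this hx
  have hN : ∀ x : E, x ^ (p ^ m + 1) ∈ V := fun x => Subring.subset_closure ⟨x, rfl⟩
  have hT : ∀ x : E, x + x ^ p ^ m ∈ V := by
    intro x
    have h1 := sub_mem (sub_mem (hN (x + 1)) (hN x)) (one_mem V)
    convert h1 using 1
    rw [pow_succ, frob, one_pow, pow_succ]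
    ring
  have hinv : ∀ x ∈ V, x⁻¹ ∈ V := by
    intro x hx
    by_cases hx0 : x = 0
    · simp [hx0]
    have := Fintype.ofFinite E
    have h1 := FiniteField.pow_card_sub_one_eq_one x hx0
    have h2 : 1 < Fintype.card E := Fintype.one_lt_card
    have h3 : x⁻¹ = x ^ (Fintype.card E - 2) := by
      symm
      apply eq_inv_of_mul_eq_one_left
      rw [← pow_succ]
      rwa [show Fintype.card E - 2 + 1 = Fintype.card E - 1 by omega]
    rw [h3]
    exact pow_mem hx _
  have key : ∀ x : E, (x ^ p ^ m) ^ p ^ m ≠ x → x ∈ V := by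
    intro x hx
    set y := x ^ p ^ m with hy
    have h1 : x - y ^ p ^ m ∈ V := by
      have := sub_mem (hT x) (hT y)
      convert this using 1
      rw [← hy]
      ring
    have h2 : (x - y ^ p ^ m) * y ∈ V := by
      have := sub_mem (hN x) (hN y)
      convert this using 1
      rw [pow_succ, pow_succ, ← hy]
      ring
    have h3 : y ∈ V := by
      have := mul_mem (hinv _ h1) h2
      rwa [inv_mul_cancel_left₀] at this
      exact sub_ne_zero.2 (Ne.symm hx)
    have := sub_mem (hT x) h3
    rwa [← hy, add_sub_cancel_right] at this
  intro b
  apply hVG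
  by_cases hb : (b ^ p ^ m) ^ p ^ m = b
  · have h1 : a + b ∈ V := by
      apply key
      rw [frob, frob, hb]
      intro h
      exact ha (add_right_cancel h)
    have := sub_mem h1 (key a ha)
    rwa [add_sub_cancel_left] at this
  · exact key b hb

lemma fix_sub {F E : Type*} [Field F] [Finite F] [Field E] [Finite E] (p : ℕ) [Fact p.Prime]
    [CharP F p] (m : ℕ) (hcard : Nat.card E = Nat.card F ^ 2)
    (h : ∀ a : E, (a ^ p ^ m) ^ p ^ m = a) (x : F) : x ^ p ^ m = x := by
  have := Fintype.ofFinite E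
  have := Fintype.ofFinite F
  obtain ⟨d, hp, hd⟩ := FiniteField.card F p
  obtain ⟨g, hg⟩ := IsCyclic.exists_ofOrder_eq_natCard (α := Eˣ)
  have hp2 : 2 ≤ p := hp.two_le
  rw [Nat.card_units, hcard, Nat.card_eq_fintype_card, hd] at hg
  have h1 : g ^ (p ^ (2 * m) - 1) = 1 := by
    have h2 : g ^ (p ^ (2 * m)) = g := by
      ext
      have := h g
      rw [← pow_mul, ← pow_add, ← two_mul] at this
      exact_mod_cast this
    have hpos : 1 ≤ p ^ (2 * m) := Nat.one_le_pow _ _ (by omega)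
    have h3 : g ^ (p ^ (2 * m) - 1) * g = 1 * g := by
      rw [← pow_succ, Nat.sub_add_cancel hpos, h2, one_mul]
    exact mul_right_cancel h3
  have h2 := orderOf_dvd_of_pow_eq_one h1
  rw [hg, ← pow_mul] at h2
  have h3 := Nat.gcd_eq_left h2
  rw [Nat.pow_sub_one_gcd_pow_sub_one] at h3
  have h4 : p ^ Nat.gcd (d * 2) (2 * m) = p ^ ((d : ℕ) * 2) := by
    have a1 : 1 ≤ p ^ Nat.gcd (d * 2) (2 * m) := Nat.one_le_pow _ _ (by omega)
    have a2 : 1 ≤ p ^ ((d : ℕ) * 2) := Nat.one_le_pow _ _ (by omega)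
    omega
  have h5 := Nat.pow_right_injective hp2 h4
  have h6 : (d : ℕ) * 2 ∣ 2 * m := h5 ▸ Nat.gcd_dvd_right _ _
  rw [mul_comm (d : ℕ)] at h6
  obtain ⟨j, rfl⟩ := Nat.dvd_of_mul_dvd_mul_left (by norm_num) h6
  rw [pow_mul, ← hd]
  exact FiniteField.pow_card_pow j x

end FF

section Mat2
variable {F : Type*} [Field F] [Finite F] {N : Type*} [AddCommGroup N]

lemma mat2 (p : ℕ) [Fact p.Prime] [CharP F p] (m : ℕ) (hm : 1 ≤ m)
    (lam : Matrix (Fin 2) (Fin 2) F →+ N) (h1 : ∀ a, lam (a + a ^ p ^ m) = 0)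
    (h2 : ∀ a, lam (a ^ (p ^ m + 1)) = 0) (A : Matrix (Fin 2) (Fin 2) F) : lam A = 0 := by
  have hp : p.Prime := Fact.out
  have hQ : 2 ≤ p ^ m := le_trans hp.two_le (Nat.le_self_pow (by omega) p)
  have hidem : ∀ a : Matrix (Fin 2) (Fin 2) F, a * a = a → lam a = 0 := by
    intro a ha
    have h3 : IsIdempotentElem a := ha
    have := h2 a
    rwa [h3.pow_succ_eq] at this
  have hnil : ∀ a : Matrix (Fin 2) (Fin 2) F, a * a = 0 → lam a = 0 := by
    intro a ha
    have := h1 a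
    have h3 : a ^ p ^ m = 0 := by
      obtain ⟨t, ht⟩ := Nat.exists_eq_add_of_le hQ
      rw [ht, pow_add, pow_two, ha, zero_mul]
    rwa [h3, add_zero] at this
  have h01 : ∀ x : F, lam !![0, x; 0, 0] = 0 := by
    intro x
    apply hnil
    simp
    ext i j; fin_cases i <;> fin_cases j <;> rfl
  have h10 : ∀ x : F, lam !![0, 0; x, 0] = 0 := by
    intro x
    apply hnil
    simp
    ext i j; fin_cases i <;> fin_cases j <;> rfl
  have hd : ∀ x : F, lam !![x, -x; x, -x] = 0 := by
    intro x
    apply hnil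
    rw [Matrix.mul_fin_two]
    ext i j; fin_cases i <;> fin_cases j <;> simp
  let mu : F →+ N :=
    { toFun := fun x => lam !![x, 0; 0, 0]
      map_zero' := by
        have : (!![0, 0; 0, 0] : Matrix (Fin 2) (Fin 2) F) = 0 := by
          ext i j; fin_cases i <;> fin_cases j <;> rfl
        rw [this, map_zero]
      map_add' := by
        intro x y
        rw [← map_add]
        congr 1
        simp }
  have hlam : ∀ A, lam A = mu (Matrix.trace A) := by
    intro A
    have e : A = !![A 0 0 + A 1 1, 0; 0, 0] + !![0, A 0 1 - A 1 1; 0, 0] + !![0, 0; A 1 0 + A 1 1, 0]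
      - !![A 1 1, -A 1 1; A 1 1, -A 1 1] := by
      ext i j; fin_cases i <;> fin_cases j <;> simp
    conv_lhs => rw [e, map_sub, map_add, map_add, h01, h10, hd, add_zero, add_zero, sub_zero]
    rw [Matrix.trace_fin_two]
    rfl
  suffices hmu : ∀ x, mu x = 0 by rw [hlam, hmu]
  let E := FiniteField.Extension F p 2
  have hE : Nat.card E = Nat.card F ^ 2 := FiniteField.natCard_extension F p 2
  have hchar : CharP E p := charP_of_injective_algebraMap (algebraMap F E).injective p
  have hfin : Finite E := Module.finite_of_finite F
  rcases dich (E := E) p m with h | h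
  · have hfix := fix_sub (F := F) p m hE h
    have c1 : ∀ c : F, mu (c + c) = 0 := by
      intro c
      have := hlam (!![c, 0; 0, 0] + !![c, 0; 0, 0] ^ p ^ m)
      rw [h1] at this
      have e : (!![c, 0; 0, 0] : Matrix (Fin 2) (Fin 2) F) = Matrix.diagonal ![c, 0] := by
        ext i j; fin_cases i <;> fin_cases j <;> rfl
      rw [e, Matrix.diagonal_pow, Matrix.trace_add, Matrix.trace_diagonal, Matrix.trace_diagonal] at this
      simp only [Fin.sum_univ_two, Pi.pow_apply, Matrix.cons_val_zero, Matrix.cons_val_one, hfix] at this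
      simpa using this.symm
    have c2 : ∀ c : F, mu (c * c) = 0 := by
      intro c
      have := hlam (!![c, 0; 0, 0] ^ (p ^ m + 1))
      rw [h2] at this
      have e : (!![c, 0; 0, 0] : Matrix (Fin 2) (Fin 2) F) = Matrix.diagonal ![c, 0] := by
        ext i j; fin_cases i <;> fin_cases j <;> rfl
      rw [e, Matrix.diagonal_pow, Matrix.trace_diagonal] at this
      simp only [Fin.sum_univ_two, Pi.pow_apply, Matrix.cons_val_zero, Matrix.cons_val_one, pow_succ, hfix] at this
      simpa using this.symm
    intro x
    by_cases hp2 : ringChar F = 2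
    · obtain ⟨y, hy⟩ := FiniteField.isSquare_of_char_two hp2 x
      rw [hy]; exact c2 y
    · have : (2 : F) ≠ 0 := Ring.two_ne_zero hp2
      have e : x = x / 2 + x / 2 := by field_simp; norm_num
      rw [e]; exact c1 _
  · let b : Module.Basis (Fin 2) F E := Module.finBasisOfFinrankEq F E (FiniteField.finrank_extension F p 2)
    let G : AddSubgroup E := (mu.comp (Algebra.trace F E).toAddMonoidHom).ker
    have hG : ∀ a, a ∈ G := by
      apply h
      intro a
      rw [AddMonoidHom.mem_ker]
      have := hlam ((Algebra.leftMulMatrix b a) ^ (p ^ m + 1))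
      rw [h2, ← map_pow, ← Algebra.trace_eq_matrix_trace] at this
      exact this.symm
    intro x
    have hsurj : Function.Surjective (Algebra.trace F E) :=
      LinearMap.surjective (Algebra.trace_ne_zero F E)
    obtain ⟨a, rfl⟩ := hsurj x
    exact hG a

/-- for larger matrices -/
lemma matN {ι : Type*} [Fintype ι] [DecidableEq ι] [Nontrivial ι] (p : ℕ) [Fact p.Prime] [CharP F p]
    (m : ℕ) (hm : 1 ≤ m)
    (lam : Matrix ι ι F →+ N) (h1 : ∀ a, lam (a + a ^ p ^ m) = 0)
    (h2 : ∀ a, lam (a ^ (p ^ m + 1)) = 0) (A : Matrix ι ι F) : lam A = 0 := by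
  have key : ∀ f : Fin 2 → ι, Function.Injective f → ∀ a b x,
      lam (Matrix.single (f a) (f b) x) = 0 := by
    intro f hf a b x
    let P : Matrix ι (Fin 2) F := Matrix.of fun i a => if i = f a then 1 else 0
    have hP : P.transpose * P = 1 := by
      ext a b
      simp [Matrix.mul_apply, P, Matrix.one_apply, hf.eq_iff, eq_comm]
    let κ : Matrix (Fin 2) (Fin 2) F →+ Matrix ι ι F :=
      { toFun := fun A => P * A * P.transpose
        map_zero' := by simp
        map_add' := by intro A B; rw [Matrix.mul_add, Matrix.add_mul] }
    have hκ : ∀ A n, κ A ^ (n + 1) = κ (A ^ (n + 1)) := by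
      intro A n
      induction n with
      | zero => simp
      | succ n ih =>
        rw [pow_succ, ih, pow_succ A (n + 1)]
        change P * A ^ (n + 1) * P.transpose * (P * A * P.transpose) = P * (A ^ (n + 1) * A) * P.transpose
        rw [Matrix.mul_assoc _ P.transpose, ← Matrix.mul_assoc P.transpose,
          ← Matrix.mul_assoc P.transpose, hP, Matrix.one_mul]
        simp only [Matrix.mul_assoc]
    have hq : ∃ t, p ^ m = t + 1 :=
      Nat.exists_eq_succ_of_ne_zero (pow_ne_zero _ (Fact.out : p.Prime).ne_zero)
    have := mat2 p m hm (lam.comp κ) (by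
      intro a
      have h3 := h1 (κ a)
      obtain ⟨t, ht⟩ := hq
      rw [ht, hκ, ← map_add, ← ht] at h3
      exact h3) (by
      intro a
      have h3 := h2 (κ a)
      rw [hκ] at h3
      exact h3) (Matrix.single a b x)
    have h4 : κ (Matrix.single a b x) = Matrix.single (f a) (f b) x := by
      ext i j
      change (P * Matrix.single a b x * P.transpose) i j = _
      rw [Matrix.mul_apply, Finset.sum_eq_single b]
      · rw [Matrix.mul_single_apply_same]
        simp only [P, Matrix.of_apply, Matrix.transpose_apply, Matrix.single_apply]
        by_cases hi : i = f a <;> by_cases hj : j = f b <;> simp [hi, hj, eq_comm]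
      · intro c _ hc
        rw [Matrix.mul_single_apply_of_ne _ _ _ _ _ hc, zero_mul]
      · simp
    rw [AddMonoidHom.comp_apply, h4] at this
    exact this
  rw [Matrix.matrix_eq_sum_single A, map_sum]
  refine Finset.sum_eq_zero fun i _ => ?_
  rw [map_sum]
  refine Finset.sum_eq_zero fun j _ => ?_
  by_cases hij : i = j
  · subst hij
    obtain ⟨l, hl⟩ := exists_ne i
    have := key ![i, l] (by
      intro a b; fin_cases a <;> fin_cases b <;> simp [hl, hl.symm]) 0 0 (A i i)
    simpa using this
  · have := key ![i, j] (by
      intro a b; fin_cases a <;> fin_cases b <;> simp [hij, Ne.symm hij]) 0 1 (A i j)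
    simpa using this

end Mat2
end WProof


namespace WProof
open Finset

variable {k R : Type*} [Field k] [Ring R] [Algebra k R] {Q : ℕ} {ε : R →ₐ[k] k}

lemma Ctx.block (C : Ctx Q ε) {F : Type*} [Field F] [Finite F] [Algebra k F] (t : ℕ)
    (p : ℕ) [Fact p.Prime] [CharP k p] (m : ℕ) (hm : 1 ≤ m) (hQ : Q = p ^ m)
    (j : Matrix (Fin t) (Fin t) F →ₗ[k] R) (hj : ∀ a b, j (a * b) = j a * j b)
    (hε : ∀ a, ε (j a) = 0) (u v : Matrix (Fin t) (Fin t) F) :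
    j (u * v ^ Q + u ^ Q * v) ∈ Wm Q ε := by
  have hpow : ∀ a n, j (a ^ (n + 1)) = j a ^ (n + 1) := by
    intro a n
    induction n with
    | zero => simp
    | succ n ih => rw [pow_succ a (n + 1), hj, ih, ← pow_succ (j a) (n + 1)]
  obtain ⟨T, hT⟩ := Nat.exists_eq_succ_of_ne_zero C.Qne
  have hpowQ : ∀ a, j (a ^ Q) = j a ^ Q := by
    intro a; rw [hT]; exact hpow a T
  rcases subsingleton_or_nontrivial (Fin t) with ht | ht
  · rw [map_add, hj, hj, hpowQ, hpowQ]
    apply C.L1 _ _ (hε _) (hε _)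
    show j u * j v = j v * j u
    rw [← hj, ← hj]
    congr 1
    ext a b
    obtain rfl := Subsingleton.elim a b
    simp [Matrix.mul_apply]
    apply Finset.sum_congr rfl
    intro c _
    obtain rfl := Subsingleton.elim a c
    exact mul_comm _ _
  · have : CharP F p := charP_of_injective_algebraMap (algebraMap k F).injective p
    have := matN (N := R ⧸ Wm Q ε) p m hm (((Wm Q ε).mkQ.comp j).toAddMonoidHom) (by
      intro a
      change (Wm Q ε).mkQ (j _) = 0
      rw [← hQ, Submodule.mkQ_apply, Submodule.Quotient.mk_eq_zero, map_add, hpowQ]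
      exact Wm_add _ (hε a)) (by
      intro a
      change (Wm Q ε).mkQ (j _) = 0
      rw [← hQ, Submodule.mkQ_apply, Submodule.Quotient.mk_eq_zero, hpow]
      exact Wm_pow _ (hε a)) (u * v ^ Q + u ^ Q * v)
    change (Wm Q ε).mkQ (j _) = 0 at this
    rwa [Submodule.mkQ_apply, Submodule.Quotient.mk_eq_zero] at this

lemma Ctx.jac_bot (C : Ctx Q ε) [Finite R] : Ring.jacobson R = ⊥ := by
  have hnil : ∀ x ∈ Ring.jacobson R, IsNilpotent x := by
    intro x hx
    obtain ⟨i, j, hij, h⟩ : ∃ i j : ℕ, i < j ∧ x ^ i = x ^ j := by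
      obtain ⟨i, j, hne, h⟩ := Finite.exists_ne_map_eq_of_infinite (fun n : ℕ => x ^ n)
      rcases lt_or_gt_of_ne hne with hl | hl
      · exact ⟨i, j, hl, h⟩
      · exact ⟨j, i, hl, h.symm⟩
    obtain ⟨d, rfl⟩ := Nat.exists_eq_add_of_lt hij
    have hu : IsUnit (1 + -(x ^ (d + 1))) := by
      apply isUnit_one_add_of_mem_jacobson
      rw [pow_succ]
      exact neg_mem (Ideal.mul_mem_left _ _ hx)
    have h0 : x ^ i * (1 + -(x ^ (d + 1))) = 0 := by
      rw [mul_add, mul_one, mul_neg, ← pow_add, ← add_assoc, ← h, add_neg_cancel]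
    exact ⟨i, by rwa [hu.mul_left_eq_zero] at h0⟩
  rw [eq_bot_iff]
  intro x hx
  rw [Submodule.mem_bot]
  apply C.L3 x
  · have := (hnil x hx).map ε
    exact this.eq_zero
  · intro a b
    apply hnil
    exact Ideal.mul_mem_right _ _ (Ideal.mul_mem_left _ _ hx)

theorem Ctx.final (C : Ctx Q ε) [Finite k] [Finite R]
    (p : ℕ) [Fact p.Prime] [CharP k p] (m : ℕ) (hm : 1 ≤ m) (hQ : Q = p ^ m)
    (u v : R) (hu : ε u = 0) (hv : ε v = 0) : u * v ^ Q + u ^ Q * v ∈ Wm Q ε := by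
  have hss : IsSemisimpleRing R := IsArtinianRing.isSemisimpleRing_iff_jacobson.2 C.jac_bot
  have : Module.Finite k R := Module.Finite.of_finite
  obtain ⟨n, D, d, iD, iA, iF, hd, ⟨e⟩⟩ :=
    IsSemisimpleRing.exists_algEquiv_pi_matrix_divisionRing_finite k R
  let j : ∀ i, Matrix (Fin (d i)) (Fin (d i)) (D i) →ₗ[k] R := fun i =>
    e.symm.toLinearMap.comp (LinearMap.single k (fun i => Matrix (Fin (d i)) (Fin (d i)) (D i)) i)
  have hjd : ∀ i a, j i a = e.symm (Pi.single i a) := fun i a => rfl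
  have hj : ∀ i a b, j i (a * b) = j i a * j i b := by
    intro i a b
    rw [hjd, hjd, hjd, ← map_mul, ← Pi.single_mul]
  have hsum : ∀ f : R, f = ∑ i, j i (e f i) := by
    intro f
    simp only [hjd]
    rw [← map_sum, Finset.univ_sum_single, AlgEquiv.symm_apply_apply]
  rw [hsum (u * v ^ Q + u ^ Q * v)]
  refine Submodule.sum_mem _ fun i _ => ?_
  have hfi : e (u * v ^ Q + u ^ Q * v) i = e u i * e v i ^ Q + e u i ^ Q * e v i := by
    simp
  rw [hfi]
  by_cases hε : ∀ a, ε (j i a) = 0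
  · have hfin : Finite (D i) := Module.finite_of_finite k
    exact C.block (F := D i) (d i) p m hm hQ (j i) (hj i) hε (e u i) (e v i)
  · have hz : ∀ w, ε w = 0 → e w i = 0 := by
      intro w hw
      by_contra hne
      apply hε
      have h1 : ∀ a c, ε (j i (a * e w i * c)) = 0 := by
        intro a c
        have : j i (a * e w i * c) = j i a * w * j i c := by
          apply e.injective
          rw [map_mul e, map_mul e, hjd, hjd, hjd]
          simp only [AlgEquiv.apply_symm_apply]
          ext1 l
          by_cases hl : l = i
          · subst hl; simp
          · simp [Pi.single_eq_of_ne hl]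
        rw [this]
        simp [hw]
      have : ∃ p q, e w i p q ≠ 0 := by
        by_contra h; push Not at h; exact hne (by ext p q; simp [h])
      obtain ⟨x, y, hxy⟩ := this
      intro a
      rw [Matrix.matrix_eq_sum_single a, map_sum, map_sum]
      refine Finset.sum_eq_zero fun r _ => ?_
      rw [map_sum, map_sum]
      refine Finset.sum_eq_zero fun s _ => ?_
      have h2 := h1 (Matrix.single r x (a r s * (e w i x y)⁻¹)) (Matrix.single y s 1)
      rw [Matrix.single_mul_mul_single] at h2
      simpa [hxy] using h2
    rw [hz u hu, hz v hv]
    simp [C.Qne]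

end WProof


namespace WProof
open Finset

lemma Wm_ker {k A : Type*} [Field k] [Ring A] [Algebra k A] {Q : ℕ} (hQ : Q ≠ 0) (ε : A →ₐ[k] k)
    (x : A) (hx : x ∈ Wm Q ε) : ε x = 0 := by
  have : Wm Q ε ≤ LinearMap.ker ε.toLinearMap := by
    rw [Wm, Submodule.span_le]
    rintro x ⟨a, ha, rfl | rfl⟩
    · simp [ha, hQ]
    · simp [ha]
  exact this hx

theorem mem_general {k A : Type*} [Field k] [Finite k] [Ring A] [Algebra k A] (ε : A →ₐ[k] k)
    (π : FreeAlgebra k (Fin 2) →ₐ[k] A) (hπ : Function.Surjective π)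
    (Q p m : ℕ) [Fact p.Prime] [CharP k p] (hm : 1 ≤ m) (hQ : Q = p ^ m)
    (u v : A) (hu : ε u = 0) (hv : ε v = 0) : u * v ^ Q + u ^ Q * v ∈ Wm Q ε := by
  have hp : p.Prime := Fact.out
  have hQ2 : 2 ≤ Q := by
    rw [hQ]; exact le_trans hp.two_le (Nat.le_self_pow (by omega) p)
  let J : Ideal A :=
    { carrier := {x | ∀ a b, a * x * b ∈ Wm Q ε}
      zero_mem' := by intro a b; simp
      add_mem' := by
        intro x y hx hy a b
        rw [mul_add, add_mul]
        exact add_mem (hx a b) (hy a b)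
      smul_mem' := by
        intro c x hx a b
        have := hx (a * c) b
        rwa [mul_assoc a c x] at this }
  have hJ : ∀ x, x ∈ J ↔ ∀ a b, a * x * b ∈ Wm Q ε := fun x => Iff.rfl
  have hJW : ∀ x ∈ J, x ∈ Wm Q ε := by
    intro x hx
    have := hx 1 1
    rwa [one_mul, mul_one] at this
  have hJ2 : J.IsTwoSided := ⟨by
    intro x c hx
    rw [hJ] at hx ⊢
    intro a b
    have := hx a (c * b)
    simpa only [mul_assoc] using this⟩
  let mk : A →ₐ[k] A ⧸ J := Ideal.Quotient.mkₐ k J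
  have hmk : Function.Surjective mk := Ideal.Quotient.mkₐ_surjective k J
  have hmk0 : ∀ x, mk x = 0 ↔ x ∈ J := fun x => Ideal.Quotient.eq_zero_iff_mem
  let ε' : (A ⧸ J) →ₐ[k] k := Ideal.Quotient.liftₐ J ε
    (fun a ha => Wm_ker (by omega) ε a (hJW a ha))
  have hε' : ∀ x, ε' (mk x) = ε x := fun x => rfl
  have hW : ∀ x, mk x ∈ Wm Q ε' → x ∈ Wm Q ε := by
    have h1 : Wm Q ε' ≤ (Wm Q ε).map mk.toLinearMap := by
      conv_lhs => rw [Wm]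
      rw [Submodule.span_le]
      rintro _ ⟨a, ha, h⟩
      obtain ⟨a, rfl⟩ := hmk a
      rw [hε'] at ha
      rcases h with rfl | rfl
      · exact ⟨a + a ^ Q, Wm_add a ha, by simp⟩
      · exact ⟨a ^ (Q + 1), Wm_pow a ha, by simp⟩
    intro x hx
    obtain ⟨y, hy, hyx⟩ := h1 hx
    have h2 : mk (x - y) = 0 := by
      rw [map_sub, sub_eq_zero]; exact hyx.symm
    have h3 := hJW _ ((hmk0 _).1 h2)
    have := add_mem h3 hy
    rwa [sub_add_cancel] at this
  have hnt : Nontrivial (A ⧸ J) := ε'.toRingHom.domain_nontrivial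
  have hchar : CharP (A ⧸ J) p := charP_of_injective_algebraMap (algebraMap k (A ⧸ J)).injective p
  have C : Ctx Q ε' :=
    { two_le := hQ2
      castQ := by
        rw [hQ, Nat.cast_pow, CharP.cast_eq_zero, zero_pow (by omega)]
      frob := by
        intro x y h
        rw [hQ]
        exact add_pow_char_pow_of_commute p m h
      H := by
        intro x hx
        obtain ⟨x, rfl⟩ := hmk x
        rw [hmk0, hJ]
        intro a b
        apply hW
        rw [map_mul, map_mul]
        exact hx _ _ }
  have hfin : Finite (A ⧸ J) := C.finite (mk.comp π) (hmk.comp hπ)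
  apply hW
  have := C.final p m hm hQ (mk u) (mk v) hu hv
  simpa using this

theorem main_aux (k : Type*) [Field k] [Fintype k] {B : Type*} [Ring B] [Algebra k B] (n : ℕ) (hn : 1 ≤ n)
    (ε : B →ₐ[k] k) (u v : B) (hu : ε u = 0) (hv : ε v = 0) :
    u * v ^ (Fintype.card k ^ n) + u ^ (Fintype.card k ^ n) * v ∈ Wm (Fintype.card k ^ n) ε := by
  obtain ⟨p, hp⟩ := CharP.exists k
  obtain ⟨d, hpp, hd⟩ := FiniteField.card k p
  have : Fact p.Prime := ⟨hpp⟩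
  set Q := Fintype.card k ^ n with hQ
  have hQ' : Q = p ^ ((d : ℕ) * n) := by rw [hQ, hd, pow_mul]
  let φ : FreeAlgebra k (Fin 2) →ₐ[k] B := FreeAlgebra.lift k ![u, v]
  let ε0 : FreeAlgebra k (Fin 2) →ₐ[k] k := FreeAlgebra.lift k (fun _ => 0)
  have hcomp : ε.comp φ = ε0 := by
    apply FreeAlgebra.hom_ext
    ext i
    fin_cases i <;> simp [φ, ε0, hu, hv]
  have hcomp' : ∀ x, ε (φ x) = ε0 x := fun x => DFunLike.congr_fun hcomp x
  have h1 := mem_general ε0 (AlgHom.id k _) Function.surjective_id Q p ((d : ℕ) * n)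
    (Nat.mul_pos d.pos hn) hQ' (FreeAlgebra.ι k 0) (FreeAlgebra.ι k 1) (by simp [ε0]) (by simp [ε0])
  have h2 : Wm Q ε0 ≤ (Wm Q ε).comap φ.toLinearMap := by
    conv_lhs => rw [Wm]
    rw [Submodule.span_le]
    rintro _ ⟨a, ha, h⟩
    rw [← hcomp'] at ha
    rcases h with rfl | rfl
    · simpa using Wm_add (Q := Q) _ ha
    · simpa using Wm_pow (Q := Q) _ ha
  have h3 := h2 h1
  simpa [φ] using h3

end WProof


lemma WProof.TSp_subst {k : Type*} [Field k] [Fintype k] {X : Type*} (H : Set (FreeAlgebra k X))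
    (h : FreeAlgebra k X) (hh : h ∈ H) (g : X → FreeAlgebra k X) (hg : ∀ x, g x ∈ AugF k X) :
    FreeAlgebra.lift k g h ∈ TSpF k X H := by
  rw [TSpF, Submodule.mem_sInf]
  rintro V ⟨hV, hHV⟩
  exact hV.2 g hg h (hHV hh)

/-- For every `n ≥ 1` and all `u, v ∈ k⟨X⟩₀`, `u v^{q^n} + u^{q^n} v ∈ W_{n,X}`. -/
theorem mul_pow_add_pow_mul_mem_WnF (x : X) (n : ℕ) (hn : 1 ≤ n)
    (u v : FreeAlgebra k X) (hu : u ∈ AugF k X) (hv : v ∈ AugF k X) :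
    u * v ^ (Fintype.card k ^ n) + u ^ (Fintype.card k ^ n) * v ∈ WnF k X x n := by
  have h1 := WProof.main_aux k n hn (FreeAlgebra.lift k (fun _ : X => (0 : k))) u v hu hv
  have h2 : WProof.Wm (Fintype.card k ^ n) (FreeAlgebra.lift k (fun _ : X => (0 : k))) ≤
      WnF k X x n := by
    rw [WProof.Wm, Submodule.span_le]
    rintro _ ⟨a, ha, h⟩
    rcases h with rfl | rfl
    · apply Submodule.mem_sup_left
      have := WProof.TSp_subst (k := k) (X := X)
        {FreeAlgebra.ι k x + FreeAlgebra.ι k x ^ (Fintype.card k ^ n)} _ rfl (fun _ => a)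
        (fun _ => ha)
      simpa using this
    · apply Submodule.mem_sup_right
      have := WProof.TSp_subst (k := k) (X := X)
        {FreeAlgebra.ι k x ^ (Fintype.card k ^ n + 1)} _ rfl (fun _ => a) (fun _ => ha)
      simpa using this
  exact h2 h1
end
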